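/- arXiv:2511.07342 — 12 statements merged into one kernel-verified Lean document; each statement's English description precedes it below -/
import Mathlib

section
/- Let n ≥ 1, A = {a₁,…,a_m} ⊆ ℤⁿ finite nonempty, k ≥ 1. Let φ : ℝ^{n+1}_{>0} → ℝ^m be the monomial map φ(u,t) = (u·t^{a₁},…,u·t^{a_m}), and let Y⁺ ⊆ ℝ^m denote the Euclidean closure of the image of φ. Let V be any function assigning to each b ∈ k·A a vector v_b ∈ ℕ^m with Σ_{j=1}^m (v_b)_j · a_j = b and Σ_{j=1}^m (v_b)_j = k, and for a coefficient vector c = (c_b)_{b∈k·A} ∈ ℝ^{k·A} set f̂(y) = Σ_{b∈k·A} c_b ∏_{j=1}^m y_j^{(v_b)_j}. Let C_{k·A} ⊆ ℝ^{k·A} be the cone of those c such that Σ_{b∈k·A} c_b t^b ≥ 0 for all t ∈ ℝⁿ_{>0}. Then c lies in the topological interior of C_{k·A} (inside ℝ^{k·A}) if and only if f̂(y) > 0 for every y ∈ Y⁺ \ {0}. -/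
open Finset
open scoped Classical

noncomputable section

lemma monomial_aux {n m : ℕ} (a : Fin m → Fin n → ℤ) (v : Fin m → ℕ) (u : ℝ) (t : Fin n → ℝ)
    (ht : ∀ i, 0 < t i) :
    ∏ j, (u * ∏ i, t i ^ (a j i)) ^ v j
      = u ^ (∑ j, v j) * ∏ i, t i ^ ((∑ j, v j • a j) i) := by
  simp_rw [mul_pow]
  rw [Finset.prod_mul_distrib, Finset.prod_pow_eq_pow_sum]
  congr 1
  simp_rw [← Finset.prod_pow]
  rw [Finset.prod_comm]
  refine Finset.prod_congr rfl fun i _ => ?_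
  have h : ∀ s : Finset (Fin m), ∏ j ∈ s, (t i ^ a j i) ^ v j = t i ^ ((∑ j ∈ s, v j • a j) i) := by
    intro s
    induction s using Finset.induction_on with
    | empty => simp
    | insert x s hx ih =>
      rw [Finset.prod_insert hx, Finset.sum_insert hx, ih, Pi.add_apply, zpow_add₀ (ht i).ne']
      congr 1
      rw [← zpow_natCast, ← zpow_mul]
      congr 1
      simp [mul_comm]
  exact h _

/-- Proposition 2.4: a coefficient vector `c ∈ ℝ^{k·A}` lies in the interior of the
sparse copositive cone `C_{k·A}` iff the induced function `f̂` is strictly positive on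
the nonnegative part of the affine toric variety (minus the origin). -/
theorem interior_sparse_copositive_cone
    {n m k : ℕ} (hn : 1 ≤ n) (hm : 1 ≤ m) (hk : 1 ≤ k)
    (a : Fin m → Fin n → ℤ)
    -- `B` is the `k`-fold Minkowski sum `k·A`
    (B : Finset (Fin n → ℤ))
    (hB : (B : Set (Fin n → ℤ)) =
      {b | ∃ v : Fin m → ℕ, (∑ j, v j) = k ∧ b = ∑ j, v j • a j})
    -- `V` assigns to each `b ∈ k·A` a decomposition `b = ∑ v_j a_j`, `∑ v_j = k`
    (V : (Fin n → ℤ) → Fin m → ℕ)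
    (hV : ∀ b ∈ B, (∑ j, V b j) = k ∧ (∑ j, V b j • a j) = b)
    -- `Yplus` is the Euclidean closure of the image of the monomial map `φ_Â`
    (Yplus : Set (Fin m → ℝ))
    (hY : Yplus = closure {y : Fin m → ℝ | ∃ u : ℝ, ∃ t : Fin n → ℝ,
        0 < u ∧ (∀ i, 0 < t i) ∧ y = fun j => u * ∏ i, t i ^ (a j i)})
    (c : {b // b ∈ B} → ℝ) :
    c ∈ interior {c' : {b // b ∈ B} → ℝ |
        ∀ t : Fin n → ℝ, (∀ i, 0 < t i) →
          0 ≤ ∑ b : {b // b ∈ B}, c' b * ∏ i, t i ^ ((b : Fin n → ℤ) i)} ↔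
      ∀ y ∈ Yplus, y ≠ 0 →
        0 < ∑ b : {b // b ∈ B}, c b * ∏ j, y j ^ V (b : Fin n → ℤ) j := by
  set S : Set (Fin m → ℝ) := {y : Fin m → ℝ | ∃ u : ℝ, ∃ t : Fin n → ℝ,
        0 < u ∧ (∀ i, 0 < t i) ∧ y = fun j => u * ∏ i, t i ^ (a j i)} with hS
  have key : ∀ (u : ℝ) (t : Fin n → ℝ), (∀ i, 0 < t i) → ∀ b : {b // b ∈ B},
      ∏ j, (u * ∏ i, t i ^ (a j i)) ^ V (b : Fin n → ℤ) j
        = u ^ k * ∏ i, t i ^ ((b : Fin n → ℤ) i) := by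
    intro u t ht b
    rw [monomial_aux a _ u t ht, (hV b b.2).1, (hV b b.2).2]
  have key2 : ∀ (u : ℝ) (t : Fin n → ℝ), (∀ i, 0 < t i) → ∀ c' : {b // b ∈ B} → ℝ,
      ∑ b : {b // b ∈ B}, c' b * ∏ j, (u * ∏ i, t i ^ (a j i)) ^ V (b : Fin n → ℤ) j
        = u ^ k * ∑ b : {b // b ∈ B}, c' b * ∏ i, t i ^ ((b : Fin n → ℤ) i) := by
    intro u t ht c'
    rw [Finset.mul_sum]
    refine Finset.sum_congr rfl fun b _ => ?_
    rw [key u t ht b]; ring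
  constructor
  · intro hc y hy hy0
    subst hY
    have hcont : Continuous fun e : ℝ => (fun b => c b - e : {b // b ∈ B} → ℝ) := by fun_prop
    have hev := hcont.continuousAt.eventually_mem (x := 0)
      (by simpa using mem_interior_iff_mem_nhds.1 hc)
    obtain ⟨e, hemem, he⟩ := ((hev.filter_mono nhdsWithin_le_nhds).and
      (self_mem_nhdsWithin : Set.Ioi (0:ℝ) ∈ nhdsWithin 0 (Set.Ioi 0))).exists
    have he : 0 < e := he
    have h1 : ∀ y ∈ closure S, 0 ≤ ∑ b : {b // b ∈ B}, (c b - e) * ∏ j, y j ^ V (b : Fin n → ℤ) j := by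
      refine fun y hy => closure_minimal (t := {y : Fin m → ℝ |
        0 ≤ ∑ b : {b // b ∈ B}, (c b - e) * ∏ j, y j ^ V (b : Fin n → ℤ) j}) ?_ ?_ hy
      · rintro _ ⟨u, t, hu, ht, rfl⟩
        have := key2 u t ht (fun b => c b - e)
        simp only [Set.mem_setOf_eq]
        rw [this]
        exact mul_nonneg (pow_pos hu k).le (hemem t ht)
      · exact isClosed_le continuous_const (by fun_prop)
    have h2 : ∀ y ∈ closure S, ∀ j, 0 ≤ y j := by
      refine fun y hy => closure_minimal (t := {y : Fin m → ℝ | ∀ j, 0 ≤ y j}) ?_ ?_ hy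
      · rintro _ ⟨u, t, hu, ht, rfl⟩ j
        exact mul_nonneg hu.le (Finset.prod_nonneg fun i _ => (zpow_pos (ht i) _).le)
      · simp only [Set.setOf_forall]
        exact isClosed_iInter fun j => isClosed_le continuous_const (by fun_prop)
    obtain ⟨j, hj⟩ : ∃ j, y j ≠ 0 := Function.ne_iff.1 hy0
    have hjB : k • a j ∈ B := by
      rw [← Finset.mem_coe, hB]
      refine ⟨Pi.single j k, by simp, ?_⟩
      rw [Finset.sum_eq_single j] <;> simp +contextual
    have h3 : ∀ y ∈ closure S, ∏ l, y l ^ V (k • a j) l = y j ^ k := by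
      refine fun y hy => closure_minimal (t := {y : Fin m → ℝ |
        ∏ l, y l ^ V (k • a j) l = y j ^ k}) ?_ ?_ hy
      · rintro _ ⟨u, t, hu, ht, rfl⟩
        have := key u t ht ⟨k • a j, hjB⟩
        simp only [Set.mem_setOf_eq]
        rw [this, mul_pow, ← Finset.prod_pow]
        congr 1
        refine Finset.prod_congr rfl fun i _ => ?_
        rw [← zpow_natCast, ← zpow_mul]
        congr 1
        simp [mul_comm]
      · exact isClosed_eq (by fun_prop) (by fun_prop)
    have h4 : 0 < ∑ b : {b // b ∈ B}, ∏ j, y j ^ V (b : Fin n → ℤ) j := by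
      refine Finset.sum_pos' (fun b _ => Finset.prod_nonneg fun l _ => pow_nonneg (h2 y hy l) _)
        ⟨⟨k • a j, hjB⟩, Finset.mem_univ _, ?_⟩
      show 0 < ∏ l, y l ^ V (k • a j) l
      rw [h3 y hy]
      exact pow_pos (lt_of_le_of_ne (h2 y hy j) (Ne.symm hj)) k
    have h5 := h1 y hy
    simp_rw [sub_mul] at h5
    rw [Finset.sum_sub_distrib, ← Finset.mul_sum] at h5
    have := mul_pos he h4
    linarith
  · intro h
    subst hY
    have hK : IsCompact (closure S ∩ Metric.sphere (0 : Fin m → ℝ) 1) :=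
      (isCompact_sphere _ _).inter_left isClosed_closure
    rw [mem_interior_iff_mem_nhds]
    have hF : Continuous fun p : ({b // b ∈ B} → ℝ) × (Fin m → ℝ) =>
        ∑ b : {b // b ∈ B}, p.1 b * ∏ j, p.2 j ^ V (b : Fin n → ℤ) j := by fun_prop
    have hev := hK.eventually_forall_of_forall_eventually (x₀ := c)
      (P := fun c' y => 0 < ∑ b : {b // b ∈ B}, c' b * ∏ j, y j ^ V (b : Fin n → ℤ) j)
      (by
        rintro y ⟨hy, hy1⟩
        have hy0 : y ≠ 0 := by
          rintro rfl
          simp at hy1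
        exact (hF.tendsto (c, y)).eventually (lt_mem_nhds (h y hy hy0)))
    filter_upwards [hev] with c' hc' t ht
    set y : Fin m → ℝ := fun j => ∏ i, t i ^ (a j i) with hyd
    have hypos : ∀ j, 0 < y j := fun j => Finset.prod_pos fun i _ => zpow_pos (ht i) _
    have hyn : 0 < ‖y‖ := by
      rw [norm_pos_iff]
      intro h0
      have := hypos ⟨0, hm⟩
      rw [h0] at this
      exact lt_irrefl _ this
    have hlt := hc' (‖y‖⁻¹ • y) ⟨subset_closure ⟨‖y‖⁻¹, t, inv_pos.2 hyn, ht, rfl⟩, by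
      rw [mem_sphere_zero_iff_norm, norm_smul, norm_inv, norm_norm, inv_mul_cancel₀ hyn.ne']⟩
    have h6 := key2 ‖y‖⁻¹ t ht c'
    have h7 : 0 < ‖y‖⁻¹ ^ k * ∑ b : {b // b ∈ B}, c' b * ∏ i, t i ^ ((b : Fin n → ℤ) i) := by
      rw [← h6]; exact hlt
    exact (pos_of_mul_pos_right h7 (pow_pos (inv_pos.2 hyn) k).le).le
end
end

section
/- Let A ⊆ ℤⁿ be a finite set such that conv(A) has affine dimension n. Let F₁,…,F_r ∈ ℤⁿ and b ∈ ℤ^r be such that conv(A) = {p ∈ ℝⁿ : ⟨F_i,p⟩ + b_i ≥ 0 for all i = 1,…,r}. Let f = Σ_{a∈A} c_a t^a be a real Laurent polynomial with supp(f) ⊆ A, and define its Cox homogenization f_cox ∈ ℝ[x₁,…,x_r] by f_cox(x) = Σ_{a∈A} c_a ∏_{i=1}^r x_i^{⟨F_i,a⟩ + b_i} (all exponents are nonnegative integers since A ⊆ conv(A)). Then f(t) ≥ 0 for all t ∈ ℝⁿ with all coordinates positive if and only if f_cox(x) ≥ 0 for all x ∈ ℝ^r with all coordinates nonnegative. -/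
open Finset

noncomputable section

/-- Cast an integer vector to a real vector. -/
def castR {n : ℕ} (b : Fin n → ℤ) : Fin n → ℝ := fun i => (b i : ℝ)

theorem cox_left_inv {n r : ℕ} (A : Finset (Fin n → ℤ))
    (hdim : affineSpan ℝ (castR '' (A : Set (Fin n → ℤ))) = ⊤)
    (F : Fin r → Fin n → ℤ) (b : Fin r → ℤ)
    (hFb : convexHull ℝ (castR '' (A : Set (Fin n → ℤ))) =
      {p : Fin n → ℝ | ∀ i, 0 ≤ (∑ l, (F i l : ℝ) * p l) + (b i : ℝ)})
    (u : Fin n → ℝ) : ∃ y : Fin r → ℝ, ∀ l, ∑ i, y i * (F i l : ℝ) = u l := by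
  classical
  let M : Matrix (Fin r) (Fin n) ℝ := Matrix.of fun i l => (F i l : ℝ)
  have hinj : Function.Injective (Matrix.toLin' M) := by
    rw [← LinearMap.ker_eq_bot, LinearMap.ker_eq_bot']
    intro v hv
    have hne : (castR '' (A : Set (Fin n → ℤ))).Nonempty := by
      rw [← affineSpan_nonempty ℝ, hdim]; exact ⟨0, trivial⟩
    obtain ⟨p, hp⟩ := hne
    have hp' := subset_convexHull ℝ _ hp
    rw [hFb] at hp'
    have hv' : ∀ i, ∑ l, (F i l : ℝ) * v l = 0 := fun i => congrFun hv i
    have hb : Bornology.IsBounded (convexHull ℝ (castR '' (A : Set (Fin n → ℤ)))) :=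
      isBounded_convexHull.2 (A.finite_toSet.image _).isBounded
    obtain ⟨C, hC⟩ := hb.exists_norm_le
    have key : ∀ s : ℝ, ‖p + s • v‖ ≤ C := by
      intro s
      apply hC
      rw [hFb]
      intro i
      have : ∑ l, (F i l : ℝ) * (p + s • v) l
          = ∑ l, (F i l : ℝ) * p l + s * ∑ l, (F i l : ℝ) * v l := by
        rw [Finset.mul_sum, ← Finset.sum_add_distrib]
        refine Finset.sum_congr rfl fun l _ => ?_
        simp only [Pi.add_apply, Pi.smul_apply, smul_eq_mul]; ring
      rw [this, hv' i]
      simpa using hp' i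
    by_contra hne
    have hvpos : 0 < ‖v‖ := norm_pos_iff.2 hne
    have h0 := key 0
    have h1 := key ((2 * C + 1) / ‖v‖)
    have hC0 : 0 ≤ C := (norm_nonneg _).trans h0
    simp only [zero_smul, add_zero] at h0
    have h2 := norm_sub_le (p + ((2 * C + 1) / ‖v‖) • v) p
    rw [add_sub_cancel_left, norm_smul, Real.norm_of_nonneg (by positivity),
      div_mul_cancel₀ _ hvpos.ne'] at h2
    linarith
  obtain ⟨g, hg⟩ := LinearMap.exists_leftInverse_of_injective _ (LinearMap.ker_eq_bot.2 hinj)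
  have hN : LinearMap.toMatrix' g * M = 1 := by
    have := congrArg LinearMap.toMatrix' hg
    rwa [LinearMap.toMatrix'_comp, LinearMap.toMatrix'_toLin', LinearMap.toMatrix'_id] at this
  refine ⟨Matrix.vecMul u (LinearMap.toMatrix' g), fun l => ?_⟩
  have : Matrix.vecMul (Matrix.vecMul u (LinearMap.toMatrix' g)) M = u := by
    rw [Matrix.vecMul_vecMul, hN, Matrix.vecMul_one]
  exact congrFun this l

theorem cox_key {n r : ℕ} (A : Finset (Fin n → ℤ))
    (F : Fin r → Fin n → ℤ) (b : Fin r → ℤ)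
    (hFb : convexHull ℝ (castR '' (A : Set (Fin n → ℤ))) =
      {p : Fin n → ℝ | ∀ i, 0 ≤ (∑ l, (F i l : ℝ) * p l) + (b i : ℝ)})
    (c : (Fin n → ℤ) → ℝ) (x : Fin r → ℝ) (hx : ∀ i, 0 < x i) :
    ∑ a ∈ A, c a * ∏ i, x i ^ ((∑ l, F i l * a l) + b i).toNat
      = (∏ i, x i ^ b i) * ∑ a ∈ A, c a * ∏ l, (∏ i, x i ^ F i l) ^ (a l) := by
  rw [Finset.mul_sum]
  refine Finset.sum_congr rfl fun a ha => ?_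
  have hmem : castR a ∈ convexHull ℝ (castR '' (A : Set (Fin n → ℤ))) :=
    subset_convexHull ℝ _ ⟨a, ha, rfl⟩
  rw [hFb] at hmem
  have h1 : ∏ i, x i ^ ((∑ l, F i l * a l) + b i).toNat
      = ∏ i, (x i ^ b i * ∏ l, (x i ^ F i l) ^ a l) := by
    refine Finset.prod_congr rfl fun i _ => ?_
    have h0 : 0 ≤ (∑ l, F i l * a l) + b i := by
      have := hmem i
      simp only [castR] at this
      exact_mod_cast this
    have h2 : ∀ s : Finset (Fin n), x i ^ (∑ l ∈ s, F i l * a l) = ∏ l ∈ s, (x i ^ F i l) ^ a l := by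
      intro s
      induction s using Finset.induction_on with
      | empty => simp
      | insert j s hj ih =>
        rw [Finset.sum_insert hj, Finset.prod_insert hj, zpow_add₀ (hx i).ne', ih, zpow_mul]
    rw [← zpow_natCast, Int.toNat_of_nonneg h0, zpow_add₀ (hx i).ne', h2, mul_comm]
  rw [h1, Finset.prod_mul_distrib, Finset.prod_comm]
  simp only [Finset.prod_zpow]
  ring

/-- Lemma 4.1: `f = ∑_{a∈A} c_a t^a` is nonnegative on `ℝⁿ_{>0}` iff its Cox
homogenization `f_cox(x) = ∑_a c_a ∏_i x_i^{⟨F_i,a⟩+b_i}` is nonnegative on `ℝ^r_{≥0}`. -/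
theorem copositive_iff_cox_copositive
    {n r : ℕ} (A : Finset (Fin n → ℤ))
    -- `conv(A)` has affine dimension `n`
    (hdim : affineSpan ℝ (castR '' (A : Set (Fin n → ℤ))) = ⊤)
    -- halfspace description `conv(A) = {p : ⟨F_i,p⟩ + b_i ≥ 0 ∀ i}`
    (F : Fin r → Fin n → ℤ) (b : Fin r → ℤ)
    (hFb : convexHull ℝ (castR '' (A : Set (Fin n → ℤ))) =
      {p : Fin n → ℝ | ∀ i, 0 ≤ (∑ l, (F i l : ℝ) * p l) + (b i : ℝ)})
    (c : (Fin n → ℤ) → ℝ) :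
    (∀ t : Fin n → ℝ, (∀ i, 0 < t i) →
        0 ≤ ∑ a ∈ A, c a * ∏ i, t i ^ (a i)) ↔
      (∀ x : Fin r → ℝ, (∀ i, 0 ≤ x i) →
        0 ≤ ∑ a ∈ A, c a * ∏ i, x i ^ ((∑ l, F i l * a l) + b i).toNat) := by
  constructor
  · intro h x hx
    have hpos : ∀ x : Fin r → ℝ, (∀ i, 0 < x i) →
        0 ≤ ∑ a ∈ A, c a * ∏ i, x i ^ ((∑ l, F i l * a l) + b i).toNat := by
      intro x hx
      rw [cox_key A F b hFb c x hx]
      exact mul_nonneg (Finset.prod_nonneg fun i _ => (zpow_pos (hx i) _).le)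
        (h _ fun l => Finset.prod_pos fun i _ => zpow_pos (hx i) _)
    have hcont : Continuous fun e : ℝ =>
        ∑ a ∈ A, c a * ∏ i, (x i + e) ^ ((∑ l, F i l * a l) + b i).toNat := by
      fun_prop
    have ht := (hcont.tendsto 0).mono_left (nhdsWithin_le_nhds (s := Set.Ioi 0))
    simp only [add_zero] at ht
    refine ge_of_tendsto ht ?_
    filter_upwards [self_mem_nhdsWithin] with e he
    exact hpos (fun i => x i + e) fun i => add_pos_of_nonneg_of_pos (hx i) he
  · intro h t ht
    obtain ⟨y, hy⟩ := cox_left_inv A hdim F b hFb (fun l => Real.log (t l))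
    have hx : ∀ i, 0 < Real.exp (y i) := fun i => Real.exp_pos _
    have h1 := h (fun i => Real.exp (y i)) fun i => (hx i).le
    rw [cox_key A F b hFb c _ hx] at h1
    have h2 : ∀ l, ∏ i, Real.exp (y i) ^ F i l = t l := by
      intro l
      rw [← Real.exp_log (ht l), ← hy l, Real.exp_sum]
      refine Finset.prod_congr rfl fun i _ => ?_
      rw [Real.exp_mul, Real.rpow_intCast]
    simp only [h2] at h1
    exact nonneg_of_mul_nonneg_right h1 (Finset.prod_pos fun i _ => zpow_pos (hx i) _)
end
end

section
/- Let A ⊆ ℤⁿ be a finite set with conv(A) of affine dimension n, and let F₁,…,F_r ∈ ℤⁿ, b ∈ ℤ^r satisfy conv(A) = {p ∈ ℝⁿ : ⟨F_i,p⟩ + b_i ≥ 0 ∀i}. Let f = Σ_{a∈A} c_a t^a with supp(f) ⊆ A and f_cox(x) = Σ_{a∈A} c_a ∏_i x_i^{⟨F_i,a⟩+b_i}. Fix a subset I ⊆ {1,…,r}, and for x ∈ ℝ^r with all coordinates positive define x_I ∈ ℝ^r by (x_I)_i = 0 if i ∈ I and (x_I)_i = x_i otherwise. Then f_cox(x_I)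 = (∏_{i=1}^r x_i^{b_i}) · Σ_{a ∈ A_I} c_a ∏_{l=1}^n (∏_{i=1}^r x_i^{(F_i)_l})^{a_l}, where A_I = {a ∈ A : ⟨F_i,a⟩ + b_i = 0 for all i ∈ I}; equivalently, f_cox(x_I) = Σ_{a∈A_I} c_a ∏_{i∉I} x_i^{⟨F_i,a⟩+b_i}. -/
open Finset
open scoped Classical

noncomputable section

/-- Lemma 4.3: setting the Cox variables indexed by `I` to zero in the Cox
homogenization computes the truncation of `f` to the closed face of `conv(A)` on
which the constraints indexed by `I` are tight. -/
theorem cox_truncation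
    {n r : ℕ} (A : Finset (Fin n → ℤ))
    (hdim : affineSpan ℝ (castR '' (A : Set (Fin n → ℤ))) = ⊤)
    (F : Fin r → Fin n → ℤ) (b : Fin r → ℤ)
    (hFb : convexHull ℝ (castR '' (A : Set (Fin n → ℤ))) =
      {p : Fin n → ℝ | ∀ i, 0 ≤ (∑ l, (F i l : ℝ) * p l) + (b i : ℝ)})
    (c : (Fin n → ℤ) → ℝ)
    (I : Finset (Fin r))
    (x : Fin r → ℝ) (hx : ∀ i, 0 < x i) :
    -- `f_cox(x_I)`, where `(x_I)_i = 0` for `i ∈ I` and `(x_I)_i = x_i` otherwise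
    ((∑ a ∈ A, c a *
        ∏ i, (if i ∈ I then (0 : ℝ) else x i) ^ ((∑ l, F i l * a l) + b i).toNat) =
      (∏ i, x i ^ (b i)) *
        (∑ a ∈ A.filter (fun a => ∀ i ∈ I, (∑ l, F i l * a l) + b i = 0),
          c a * ∏ l, (∏ i, x i ^ (F i l)) ^ (a l)))
    ∧
    ((∑ a ∈ A, c a *
        ∏ i, (if i ∈ I then (0 : ℝ) else x i) ^ ((∑ l, F i l * a l) + b i).toNat) =
      ∑ a ∈ A.filter (fun a => ∀ i ∈ I, (∑ l, F i l * a l) + b i = 0),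
        c a * ∏ i ∈ Iᶜ, x i ^ ((∑ l, F i l * a l) + b i).toNat) := by
  have hnn : ∀ a ∈ A, ∀ i, 0 ≤ (∑ l, F i l * a l) + b i := by
    intro a ha i
    have h1 : castR a ∈ convexHull ℝ (castR '' (A : Set (Fin n → ℤ))) :=
      subset_convexHull ℝ _ ⟨a, ha, rfl⟩
    rw [hFb] at h1
    have h2 := h1 i
    simp only [castR] at h2
    exact_mod_cast h2
  have h2 : (∑ a ∈ A, c a *
        ∏ i, (if i ∈ I then (0 : ℝ) else x i) ^ ((∑ l, F i l * a l) + b i).toNat) =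
      ∑ a ∈ A.filter (fun a => ∀ i ∈ I, (∑ l, F i l * a l) + b i = 0),
        c a * ∏ i ∈ Iᶜ, x i ^ ((∑ l, F i l * a l) + b i).toNat := by
    rw [Finset.sum_filter]
    refine Finset.sum_congr rfl fun a ha => ?_
    split_ifs with h
    · congr 1
      rw [← Finset.prod_mul_prod_compl I, Finset.prod_eq_one, one_mul]
      · refine Finset.prod_congr rfl fun i hi => ?_
        rw [if_neg (Finset.mem_compl.mp hi)]
      · intro i hi
        rw [h i hi]
        simp
    · push Not at h
      obtain ⟨i, hi, hne⟩ := h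
      rw [Finset.prod_eq_zero (Finset.mem_univ i), mul_zero]
      rw [if_pos hi]
      apply zero_pow
      have := hnn a ha i
      omega
  refine ⟨?_, h2⟩
  rw [h2, Finset.mul_sum]
  refine Finset.sum_congr rfl fun a ha => ?_
  obtain ⟨haA, h⟩ := Finset.mem_filter.mp ha
  rw [mul_left_comm]
  congr 1
  have e1 : ∏ l, (∏ i, x i ^ (F i l)) ^ (a l) = ∏ i, x i ^ (∑ l, F i l * a l) := by
    simp_rw [← Finset.prod_zpow, ← zpow_mul]
    rw [Finset.prod_comm]
    refine Finset.prod_congr rfl fun i _ => ?_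
    generalize (Finset.univ : Finset (Fin n)) = s
    induction s using Finset.induction_on with
    | empty => simp
    | insert j s hj ih =>
      rw [Finset.prod_insert hj, Finset.sum_insert hj, zpow_add₀ (hx i).ne', ih]
  rw [e1, ← Finset.prod_mul_distrib, ← Finset.prod_mul_prod_compl I]
  rw [Finset.prod_eq_one (s := I), one_mul]
  · refine Finset.prod_congr rfl fun i _ => ?_
    rw [← zpow_add₀ (hx i).ne', add_comm (b i), ← zpow_natCast, Int.toNat_of_nonneg (hnn a haA i)]
  · intro i hi
    rw [← zpow_add₀ (hx i).ne', add_comm (b i), h i hi, zpow_zero]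
end
end

section
/- Let A ⊆ ℤⁿ be a finite set with conv(A) of affine dimension n, and let F₁,…,F_r ∈ ℤⁿ, b ∈ ℤ^r satisfy conv(A) = {p ∈ ℝⁿ : ⟨F_i,p⟩ + b_i ≥ 0 ∀i}. Let f = Σ_{a∈A} c_a t^a with supp(f) ⊆ A and f_cox(x) = Σ_{a∈A} c_a ∏_i x_i^{⟨F_i,a⟩+b_i} ∈ ℝ[x₁,…,x_r]. Suppose x ∈ ℂ^r is such that for every extreme point v of conv(A) one has ∏_{i : ⟨F_i,v⟩+b_i>0} x_i = 0. Then f_cox(x) = 0. -/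
open Finset
open scoped Classical

noncomputable section

/-- Lemma 4.4: the Cox homogenization of any `f` supported in `A` vanishes at every
point of the vanishing locus of the irrelevant ideal (described via the vertices of
`conv(A)`: the generator attached to a vertex `v` is the product of the variables
`x_i` over the constraints `i` not tight at `v`). -/
theorem cox_vanishes_on_irrelevant_locus
    {n r : ℕ} (A : Finset (Fin n → ℤ))
    (hdim : affineSpan ℝ (castR '' (A : Set (Fin n → ℤ))) = ⊤)
    (F : Fin r → Fin n → ℤ) (b : Fin r → ℤ)
    (hFb : convexHull ℝ (castR '' (A : Set (Fin n → ℤ))) =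
      {p : Fin n → ℝ | ∀ i, 0 ≤ (∑ l, (F i l : ℝ) * p l) + (b i : ℝ)})
    (c : (Fin n → ℤ) → ℝ)
    (x : Fin r → ℂ)
    (hx : ∀ v ∈ Set.extremePoints ℝ (convexHull ℝ (castR '' (A : Set (Fin n → ℤ)))),
      (∏ i ∈ univ.filter (fun i => 0 < (∑ l, (F i l : ℝ) * v l) + (b i : ℝ)), x i) = 0) :
    (∑ a ∈ A, (c a : ℂ) * ∏ i, x i ^ ((∑ l, F i l * a l) + b i).toNat) = 0 := by
  set K := convexHull ℝ (castR '' (A : Set (Fin n → ℤ))) with hK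
  have hKc : IsCompact K := (A.finite_toSet.image _).isCompact_convexHull ℝ
  refine Finset.sum_eq_zero fun a ha => ?_
  have haK : castR a ∈ K := subset_convexHull ℝ _ ⟨a, ha, rfl⟩
  let L : Fin r → (Fin n → ℝ) → ℝ := fun i p => (∑ l, (F i l : ℝ) * p l) + (b i : ℝ)
  have hLc : ∀ i, Continuous (L i) := fun i => by
    simp only [L]
    fun_prop
  have hKL : ∀ p, p ∈ K → ∀ i, 0 ≤ L i p := fun p hp => by
    rw [hFb] at hp
    exact hp
  let T : Set (Fin n → ℝ) := K ∩ {p | ∀ i, L i (castR a) = 0 → L i p = 0}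
  have hTc : IsCompact T := by
    refine hKc.inter_right ?_
    simp only [Set.ofPred_forall]
    exact isClosed_iInter fun i => isClosed_iInter fun _ =>
      isClosed_eq (hLc i) continuous_const
  have hext : IsExtreme ℝ K T := by
    refine ⟨Set.inter_subset_left, ?_⟩
    rintro p hp q hq z hz ⟨s, t, hs, ht, hst, rfl⟩
    refine ⟨hp, fun i hi => ?_⟩
    have h0 := hz.2 i hi
    have h1 : L i (s • p + t • q) = s * L i p + t * L i q := by
      have : (b i : ℝ) = s * b i + t * b i := by rw [← add_mul, hst, one_mul]
      simp only [L, Pi.add_apply, Pi.smul_apply, smul_eq_mul, mul_add, Finset.sum_add_distrib,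
        Finset.mul_sum, mul_left_comm]
      linarith
    have hp0 := hKL p hp i
    have hq0 := mul_nonneg ht.le (hKL q hq i)
    have hsp := mul_nonneg hs.le hp0
    have : s * L i p = 0 := by linarith
    exact (mul_eq_zero.mp this).resolve_left hs.ne'
  obtain ⟨v, hv⟩ := hTc.extremePoints_nonempty ⟨castR a, haK, fun i hi => hi⟩
  have hvT : v ∈ T := hv.1
  have hvx := hx v (hext.extremePoints_subset_extremePoints hv)
  obtain ⟨i, hi, hxi⟩ := Finset.prod_eq_zero_iff.mp hvx
  have hi' : 0 < L i v := (Finset.mem_filter.mp hi).2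
  have hpos : 0 < L i (castR a) := by
    refine lt_of_le_of_ne (hKL _ haK i) fun h => ?_
    exact hi'.ne' (hvT.2 i h.symm)
  have hposZ : 0 < (∑ l, F i l * a l) + b i := by
    simp only [L, castR] at hpos
    exact_mod_cast hpos
  rw [Finset.prod_eq_zero (Finset.mem_univ i), mul_zero]
  rw [hxi]
  exact zero_pow (by omega)
end
end

section
/- Let A ⊆ ℤⁿ be a finite set with conv(A) of affine dimension n, and let F₁,…,F_r ∈ ℤⁿ, b ∈ ℤ^r satisfy conv(A) = {p ∈ ℝⁿ : ⟨F_i,p⟩ + b_i ≥ 0 ∀i}. Let f = Σ_{a∈A} c_a t^a with supp(f) ⊆ A and f_cox(x) = Σ_{a∈A} c_a ∏_i x_i^{⟨F_i,a⟩+b_i}. Define Z⁺ = {x ∈ ℝ^r_{≥0} : for every extreme point v of conv(A), ∏_{i : ⟨F_i,v⟩+b_i>0} x_i = 0}. Then the following are equivalent: (1) for every w ∈ ℝⁿ, writing F_w = {a ∈ A : ⟨w,a⟩ = min_{a'∈A}⟨w,a'⟩}, one has Σ_{a∈F_w} c_a t^a > 0 for all t ∈ ℝⁿ_{>0} (f is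 strictly A-copositive); (2) f_cox(x) ≥ 0 for all x ∈ ℝ^r_{≥0}, and {x ∈ ℝ^r_{≥0} : f_cox(x) = 0} = Z⁺. -/
open Finset
open scoped Classical

noncomputable section

/-- Standard scalar product on `ℝⁿ`. -/
def dotR {n : ℕ} (w p : Fin n → ℝ) : ℝ := ∑ i, w i * p i


def eZ {n r : ℕ} (F : Fin r → Fin n → ℤ) (b : Fin r → ℤ) (i : Fin r) (a : Fin n → ℤ) : ℤ :=
  (∑ l, F i l * a l) + b i

lemma eZ_cast {n r : ℕ} (F : Fin r → Fin n → ℤ) (b : Fin r → ℤ) (i : Fin r) (a : Fin n → ℤ) :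
    ((eZ F b i a : ℤ) : ℝ) = (∑ l, (F i l : ℝ) * castR a l) + (b i : ℝ) := by
  simp [eZ, castR]

lemma mono_eq {n r : ℕ} (F : Fin r → Fin n → ℤ) (b : Fin r → ℤ) (a : Fin n → ℤ)
    (x y : Fin r → ℝ) (t : Fin n → ℝ)
    (ht : ∀ l, t l = Real.exp (∑ i, y i * F i l))
    (he : ∀ i, 0 ≤ eZ F b i a)
    (hx : ∀ i, x i = Real.exp (y i) ∨ eZ F b i a = 0) :
    ∏ i, x i ^ (eZ F b i a).toNat
      = Real.exp (∑ i, y i * b i) * ∏ l, t l ^ (a l) := by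
  have h1 : ∀ i, x i ^ (eZ F b i a).toNat = Real.exp (y i * (eZ F b i a : ℤ)) := by
    intro i
    rcases hx i with h | h
    · rw [h, ← Real.exp_nat_mul]
      have : (((eZ F b i a).toNat : ℕ) : ℝ) = ((eZ F b i a : ℤ) : ℝ) := by
        exact_mod_cast congrArg (Int.cast (R := ℝ)) (Int.toNat_of_nonneg (he i))
      rw [this, mul_comm]
    · simp [h]
  have h2 : ∀ l, t l ^ (a l) = Real.exp (∑ i, y i * F i l * a l) := by
    intro l
    rw [ht, ← Real.rpow_intCast, ← Real.exp_mul, Finset.sum_mul]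
  simp_rw [h1, h2]
  rw [← Real.exp_sum, ← Real.exp_sum, ← Real.exp_add, Finset.sum_comm, ← Finset.sum_add_distrib]
  congr 1
  refine Finset.sum_congr rfl fun i _ => ?_
  simp only [eZ]
  push_cast
  rw [mul_add, Finset.mul_sum, add_comm]
  simp [mul_assoc]

lemma cox_eq {n r : ℕ} (A : Finset (Fin n → ℤ)) (F : Fin r → Fin n → ℤ) (b : Fin r → ℤ)
    (c : (Fin n → ℤ) → ℝ)
    (x y : Fin r → ℝ) (t : Fin n → ℝ)
    (ht : ∀ l, t l = Real.exp (∑ i, y i * F i l))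
    (he : ∀ a ∈ A, ∀ i, 0 ≤ eZ F b i a)
    (hx : ∀ i, x i ≠ 0 → x i = Real.exp (y i)) :
    ∑ a ∈ A, c a * ∏ i, x i ^ (eZ F b i a).toNat
      = Real.exp (∑ i, y i * b i) *
        ∑ a ∈ A.filter (fun a => ∀ i, x i = 0 → eZ F b i a = 0), c a * ∏ l, t l ^ (a l) := by
  rw [Finset.mul_sum, Finset.sum_filter]
  refine Finset.sum_congr rfl fun a ha => ?_
  split_ifs with h
  · rw [mono_eq F b a x y t ht (he a ha)]
    · ring
    · intro i
      by_cases h0 : x i = 0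
      · exact Or.inr (h i h0)
      · exact Or.inl (hx i h0)
  · push Not at h
    obtain ⟨i, hi, hne⟩ := h
    have : ∏ i, x i ^ (eZ F b i a).toNat = 0 := by
      apply Finset.prod_eq_zero (Finset.mem_univ i)
      rw [hi]
      apply zero_pow
      have := he a ha i
      omega
    simp [this]

lemma vert_iff {n r : ℕ} (A : Finset (Fin n → ℤ))
    (F : Fin r → Fin n → ℤ) (b : Fin r → ℤ)
    (hFb : convexHull ℝ (castR '' (A : Set (Fin n → ℤ))) =
      {p : Fin n → ℝ | ∀ i, 0 ≤ (∑ l, (F i l : ℝ) * p l) + (b i : ℝ)})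
    (x : Fin r → ℝ) :
    (∀ v ∈ Set.extremePoints ℝ (convexHull ℝ (castR '' (A : Set (Fin n → ℤ)))),
              (∏ i ∈ univ.filter (fun i => 0 < (∑ l, (F i l : ℝ) * v l) + (b i : ℝ)),
                x i) = 0) ↔ ¬ ∃ a ∈ A, ∀ i, x i = 0 → eZ F b i a = 0 := by
  set P := convexHull ℝ (castR '' (A : Set (Fin n → ℤ))) with hP
  constructor
  · rintro h ⟨a, ha, hax⟩
    let Q : Set (Fin n → ℝ) :=
      {p | p ∈ P ∧ ∀ i, x i = 0 → (∑ l, (F i l : ℝ) * p l) + (b i : ℝ) = 0}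
    have hPc : IsCompact P := (A.finite_toSet.image _).isCompact_convexHull (𝕜 := ℝ)
    have hQc : IsCompact Q := by
      have : Q = P ∩ ⋂ i, ⋂ (_ : x i = 0),
          {p | (∑ l, (F i l : ℝ) * p l) + (b i : ℝ) = 0} := by
        ext p; simp [Q]
      rw [this]
      refine hPc.inter_right (isClosed_iInter fun i => isClosed_iInter fun _ => ?_)
      exact isClosed_eq (by fun_prop) (by fun_prop)
    have hQn : Q.Nonempty := by
      refine ⟨castR a, subset_convexHull ℝ _ ⟨a, ha, rfl⟩, fun i hi => ?_⟩
      rw [← eZ_cast, hax i hi]; simp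
    obtain ⟨v, hv⟩ := hQc.extremePoints_nonempty hQn
    have hext : IsExtreme ℝ P Q := by
      refine ⟨fun p hp => hp.1, ?_⟩
      rintro p hp q hq z hz ⟨s, u, hs, hu, hsu, rfl⟩
      refine ⟨hp, fun i hi => ?_⟩
      have h1 := hz.2 i hi
      have hp' := hp; have hq' := hq
      rw [hFb] at hp' hq'
      have h2 := hp' i
      have h3 := hq' i
      have h4 : (∑ l, (F i l : ℝ) * (s • p + u • q) l) + (b i : ℝ)
          = s * ((∑ l, (F i l : ℝ) * p l) + (b i : ℝ))
            + u * ((∑ l, (F i l : ℝ) * q l) + (b i : ℝ)) := by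
        have hb : (b i : ℝ) = s * b i + u * b i := by rw [← add_mul, hsu, one_mul]
        conv_lhs => rw [hb]
        simp only [Pi.add_apply, Pi.smul_apply, smul_eq_mul, mul_add, Finset.sum_add_distrib,
          Finset.mul_sum]
        simp only [mul_left_comm]
        ring
      rw [h4] at h1
      have h5 := mul_nonneg hs.le h2
      have h6 := mul_nonneg hu.le h3
      have h7 : s * ((∑ l, (F i l : ℝ) * p l) + (b i : ℝ)) = 0 := by linarith
      exact (mul_eq_zero.1 h7).resolve_left hs.ne'
    have hvP := hext.extremePoints_subset_extremePoints hv
    have := h v hvP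
    rw [Finset.prod_eq_zero_iff] at this
    obtain ⟨i, hi, hi0⟩ := this
    have h1 := hv.1.2 i hi0
    have h2 := (Finset.mem_filter.1 hi).2
    linarith
  · intro h v hv
    by_contra hne
    apply h
    obtain ⟨a, ha, rfl⟩ := extremePoints_convexHull_subset hv
    refine ⟨a, ha, fun i hi => ?_⟩
    replace hne := Finset.prod_ne_zero_iff.1 hne
    by_contra h0
    have hp := hv.1
    rw [hFb] at hp
    have h1 := hp i
    refine hne i (Finset.mem_filter.2 ⟨Finset.mem_univ _, lt_of_le_of_ne h1 ?_⟩) hi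
    rw [← eZ_cast]
    exact_mod_cast Ne.symm h0

lemma span_F {n r : ℕ} (A : Finset (Fin n → ℤ)) (hA : A.Nonempty)
    (F : Fin r → Fin n → ℤ) (b : Fin r → ℤ)
    (hFb : convexHull ℝ (castR '' (A : Set (Fin n → ℤ))) =
      {p : Fin n → ℝ | ∀ i, 0 ≤ (∑ l, (F i l : ℝ) * p l) + (b i : ℝ)})
    (u : Fin n → ℝ) : ∃ y : Fin r → ℝ, ∀ l, u l = ∑ i, y i * F i l := by
  let V : Submodule ℝ (Fin n → ℝ) := Submodule.span ℝ (Set.range fun i => castR (F i))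
  have hV : V = ⊤ := by
    by_contra hne
    obtain ⟨φ, hφ, hle⟩ := Submodule.exists_le_ker_of_lt_top V (lt_top_iff_ne_top.2 hne)
    let d : Fin n → ℝ := fun l => φ (Pi.single l 1)
    have hφd : ∀ p, φ p = ∑ l, p l * d l := by
      intro p
      conv_lhs => rw [pi_eq_sum_univ' p]
      simp [map_sum, d]
    have hd : ∀ i, ∑ l, (F i l : ℝ) * d l = 0 := by
      intro i
      have : castR (F i) ∈ LinearMap.ker φ := hle (Submodule.subset_span ⟨i, rfl⟩)
      rw [LinearMap.mem_ker, hφd] at this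
      exact this
    obtain ⟨a, ha⟩ := hA
    have hPc : IsCompact (convexHull ℝ (castR '' (A : Set (Fin n → ℤ)))) :=
      (A.finite_toSet.image _).isCompact_convexHull (𝕜 := ℝ)
    have haP : castR a ∈ convexHull ℝ (castR '' (A : Set (Fin n → ℤ))) :=
      subset_convexHull ℝ _ ⟨a, ha, rfl⟩
    have hray : ∀ s : ℝ, castR a + s • d ∈ convexHull ℝ (castR '' (A : Set (Fin n → ℤ))) := by
      intro s
      rw [hFb] at haP ⊢
      intro i
      have h1 := haP i
      have : ∑ l, (F i l : ℝ) * (castR a + s • d) l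
          = ∑ l, (F i l : ℝ) * castR a l + s * ∑ l, (F i l : ℝ) * d l := by
        rw [Finset.mul_sum, ← Finset.sum_add_distrib]
        refine Finset.sum_congr rfl fun l _ => ?_
        simp; ring
      rw [this, hd]
      simpa using h1
    apply hφ
    have hd0 : ∀ l, d l = 0 := by
      intro l
      by_contra hl
      obtain ⟨M, hM⟩ := hPc.isBounded.exists_norm_le
      have h1 := hM _ (hray ((|M| + 1 - castR a l) / d l))
      have h2 := norm_le_pi_norm (castR a + ((|M| + 1 - castR a l) / d l) • d) l
      have h3 : (castR a + ((|M| + 1 - castR a l) / d l) • d) l = |M| + 1 := by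
        simp; field_simp; ring
      rw [h3, Real.norm_eq_abs] at h2
      have := le_abs_self (|M| + 1)
      have := le_abs_self M
      linarith
    ext p
    simp [d] at hd0
    simp [hd0]
  have hu : u ∈ V := hV ▸ Submodule.mem_top
  obtain ⟨y, hy⟩ := (Submodule.mem_span_range_iff_exists_fun ℝ).1 hu
  refine ⟨y, fun l => ?_⟩
  rw [← hy]
  simp [castR]

lemma face_eq {n r : ℕ} (A : Finset (Fin n → ℤ)) (hA : A.Nonempty)
    (F : Fin r → Fin n → ℤ) (b : Fin r → ℤ)
    (hFb : convexHull ℝ (castR '' (A : Set (Fin n → ℤ))) =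
      {p : Fin n → ℝ | ∀ i, 0 ≤ (∑ l, (F i l : ℝ) * p l) + (b i : ℝ)})
    (he : ∀ a ∈ A, ∀ i, 0 ≤ eZ F b i a)
    (w : Fin n → ℝ) (G : Finset (Fin n → ℤ))
    (hG : G = A.filter (fun a => ∀ a' ∈ A, dotR w (castR a) ≤ dotR w (castR a')))
    (I : Fin r → Prop) (hI : ∀ i, I i ↔ ∀ a ∈ G, eZ F b i a = 0) :
    G.Nonempty ∧ A.filter (fun a => ∀ i, I i → eZ F b i a = 0) = G := by
  have hGn : G.Nonempty := by
    obtain ⟨a, ha, h⟩ := A.exists_min_image (fun a => dotR w (castR a)) hA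
    exact ⟨a, by rw [hG]; exact Finset.mem_filter.2 ⟨ha, h⟩⟩
  refine ⟨hGn, ?_⟩
  have hGA : G ⊆ A := by rw [hG]; exact Finset.filter_subset _ _
  apply Finset.Subset.antisymm
  · intro a ha
    obtain ⟨haA, haI⟩ := Finset.mem_filter.1 ha
    -- the unnormalized barycenter
    obtain ⟨g, hg⟩ := hGn
    have hmin : ∀ g' ∈ G, dotR w (castR g') = dotR w (castR g) := by
      intro g' hg'
      rw [hG, Finset.mem_filter] at hg hg'
      exact le_antisymm (hg'.2 _ hg.1) (hg.2 _ hg'.1)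
    have hlow : ∀ q ∈ convexHull ℝ (castR '' (A : Set (Fin n → ℤ))),
        dotR w (castR g) ≤ dotR w q := by
      have hc : Convex ℝ {q : Fin n → ℝ | dotR w (castR g) ≤ dotR w q} := by
        apply convex_halfSpace_ge
        constructor
        · intro p q; simp [dotR, mul_add, Finset.sum_add_distrib]
        · intro s p; simp [dotR, Finset.mul_sum, mul_left_comm]
      refine fun q hq => convexHull_min ?_ hc hq
      rintro _ ⟨a', ha', rfl⟩
      rw [hG, Finset.mem_filter] at hg
      exact hg.2 _ ha'
    have hN : (0 : ℝ) < G.card := by exact_mod_cast Finset.card_pos.2 ⟨g, hg⟩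
    set N : ℝ := (G.card : ℝ) with hNdef
    let p : Fin n → ℝ := fun l => (∑ g' ∈ G, castR g' l) / N
    have hlin : ∀ z : Fin n → ℝ, ∑ l, z l * p l = (∑ g' ∈ G, ∑ l, z l * castR g' l) / N := by
      intro z
      rw [Finset.sum_comm, Finset.sum_div]
      refine Finset.sum_congr rfl fun l _ => ?_
      simp only [p]
      rw [← Finset.mul_sum, mul_div_assoc]
    have hpF : ∀ i, (∑ l, (F i l : ℝ) * p l) + (b i : ℝ) = (∑ g' ∈ G, (eZ F b i g' : ℝ)) / N := by
      intro i
      rw [hlin (fun l => (F i l : ℝ))]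
      simp_rw [eZ_cast]
      rw [Finset.sum_add_distrib, Finset.sum_const, nsmul_eq_mul, add_div, ← hNdef,
        mul_div_cancel_left₀ _ hN.ne']
    have hpw : dotR w p = dotR w (castR g) := by
      have : dotR w p = (∑ g' ∈ G, dotR w (castR g')) / N := hlin w
      rw [this, Finset.sum_congr rfl hmin, Finset.sum_const, nsmul_eq_mul, ← hNdef,
        mul_div_cancel_left₀ _ hN.ne']
    -- small epsilon
    have key : ∃ ε : ℝ, 0 < ε ∧ ∀ i, 0 ≤ (1 + ε) * ((∑ l, (F i l : ℝ) * p l) + (b i : ℝ))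
        - ε * (eZ F b i a : ℝ) := by
      have hev : ∀ᶠ ε : ℝ in nhdsWithin 0 (Set.Ioi 0), ∀ i,
          0 ≤ (1 + ε) * ((∑ l, (F i l : ℝ) * p l) + (b i : ℝ)) - ε * (eZ F b i a : ℝ) := by
        rw [Filter.eventually_all]
        intro i
        by_cases hi : I i
        · have h0 := haI i hi
          have h1 : (∑ l, (F i l : ℝ) * p l) + (b i : ℝ) = 0 := by
            rw [hpF, Finset.sum_eq_zero]
            · simp
            · intro g' hg'
              rw [(hI i).1 hi g' hg']; simp
          filter_upwards with ε
          rw [h0, h1]; simp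
        · have h1 : 0 < (∑ l, (F i l : ℝ) * p l) + (b i : ℝ) := by
            rw [hpF]
            apply div_pos _ hN
            rw [hI] at hi
            push Not at hi
            obtain ⟨g', hg', hne⟩ := hi
            apply Finset.sum_pos'
            · intro k hk
              exact_mod_cast he k (hGA hk) i
            · refine ⟨g', hg', ?_⟩
              have := he g' (hGA hg') i
              have : 0 < eZ F b i g' := by omega
              exact_mod_cast this
          have hc : Filter.Tendsto (fun ε : ℝ => (1 + ε) * ((∑ l, (F i l : ℝ) * p l) + (b i : ℝ))
              - ε * (eZ F b i a : ℝ)) (nhds 0) (nhds ((1 + 0) * ((∑ l, (F i l : ℝ) * p l) + (b i : ℝ))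
              - 0 * (eZ F b i a : ℝ))) :=
            Continuous.tendsto (by fun_prop) 0
          have := hc.eventually (lt_mem_nhds (a := 0) (by simpa using h1))
          filter_upwards [nhdsWithin_le_nhds this] with ε h using h.le
      obtain ⟨ε, h1, h2⟩ := (hev.and self_mem_nhdsWithin).exists
      exact ⟨ε, h2, h1⟩
    obtain ⟨ε, hε, hall⟩ := key
    have hq := hlow ((1 + ε) • p - ε • castR a) (by
      rw [hFb]
      intro i
      have h1 := hall i
      rw [eZ_cast] at h1
      have : ∑ l, (F i l : ℝ) * ((1 + ε) • p - ε • castR a) l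
          = (1 + ε) * (∑ l, (F i l : ℝ) * p l) - ε * ∑ l, (F i l : ℝ) * castR a l := by
        rw [Finset.mul_sum, Finset.mul_sum, ← Finset.sum_sub_distrib]
        refine Finset.sum_congr rfl fun l _ => ?_
        simp; ring
      rw [this]
      linarith)
    have hw : dotR w ((1 + ε) • p - ε • castR a)
        = (1 + ε) * dotR w p - ε * dotR w (castR a) := by
      simp only [dotR]
      rw [Finset.mul_sum, Finset.mul_sum, ← Finset.sum_sub_distrib]
      refine Finset.sum_congr rfl fun l _ => ?_
      simp; ring
    rw [hw, hpw] at hq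
    have hag : dotR w (castR a) ≤ dotR w (castR g) := by
      have : ε * dotR w (castR a) ≤ ε * dotR w (castR g) := by linarith
      exact le_of_mul_le_mul_left this hε
    rw [hG, Finset.mem_filter]
    refine ⟨haA, fun a' ha' => hag.trans ?_⟩
    rw [hG, Finset.mem_filter] at hg
    exact hg.2 _ ha'
  · intro a ha
    exact Finset.mem_filter.2 ⟨hGA ha, fun i hi => (hI i).1 hi a ha⟩

/-- Proposition 4.5: `f` is strictly `A`-copositive iff its Cox homogenization is
copositive and its nonnegative real zero set is exactly the nonnegative part `Z⁺`
of the vanishing locus of the irrelevant ideal. -/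
theorem strictA_copositive_iff_cox
    {n r : ℕ} (A : Finset (Fin n → ℤ))
    (hdim : affineSpan ℝ (castR '' (A : Set (Fin n → ℤ))) = ⊤)
    (F : Fin r → Fin n → ℤ) (b : Fin r → ℤ)
    (hFb : convexHull ℝ (castR '' (A : Set (Fin n → ℤ))) =
      {p : Fin n → ℝ | ∀ i, 0 ≤ (∑ l, (F i l : ℝ) * p l) + (b i : ℝ)})
    (c : (Fin n → ℤ) → ℝ) :
    -- (1): all face truncations of `f` are positive on `ℝⁿ_{>0}`
    ((∀ w : Fin n → ℝ, ∀ t : Fin n → ℝ, (∀ i, 0 < t i) →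
        0 < ∑ a ∈ A.filter (fun a => ∀ a' ∈ A, dotR w (castR a) ≤ dotR w (castR a')),
              c a * ∏ i, t i ^ (a i))
      ↔
    -- (2): `f_cox` is copositive and its nonnegative zero locus is `Z⁺`
      ((∀ x : Fin r → ℝ, (∀ i, 0 ≤ x i) →
          0 ≤ ∑ a ∈ A, c a * ∏ i, x i ^ ((∑ l, F i l * a l) + b i).toNat) ∧
        {x : Fin r → ℝ | (∀ i, 0 ≤ x i) ∧
            (∑ a ∈ A, c a * ∏ i, x i ^ ((∑ l, F i l * a l) + b i).toNat) = 0} =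
          {x : Fin r → ℝ | (∀ i, 0 ≤ x i) ∧
            ∀ v ∈ Set.extremePoints ℝ (convexHull ℝ (castR '' (A : Set (Fin n → ℤ)))),
              (∏ i ∈ univ.filter (fun i => 0 < (∑ l, (F i l : ℝ) * v l) + (b i : ℝ)),
                x i) = 0})) := by
  have hA : A.Nonempty := by
    rw [Finset.nonempty_iff_ne_empty]
    rintro rfl
    simp at hdim
  have he : ∀ a ∈ A, ∀ i, 0 ≤ eZ F b i a := by
    intro a ha i
    have haP : castR a ∈ convexHull ℝ (castR '' (A : Set (Fin n → ℤ))) :=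
      subset_convexHull ℝ _ ⟨a, ha, rfl⟩
    rw [hFb] at haP
    have := haP i
    rw [← eZ_cast] at this
    exact_mod_cast this
  simp only [vert_iff A F b hFb]
  change _ ↔ (∀ x : Fin r → ℝ, (∀ i, 0 ≤ x i) →
      0 ≤ ∑ a ∈ A, c a * ∏ i, x i ^ (eZ F b i a).toNat) ∧
      {x : Fin r → ℝ | (∀ i, 0 ≤ x i) ∧
        (∑ a ∈ A, c a * ∏ i, x i ^ (eZ F b i a).toNat) = 0} = _
  constructor
  · intro h
    have hpos : ∀ x : Fin r → ℝ, (∀ i, 0 ≤ x i) →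
        (∃ a ∈ A, ∀ i, x i = 0 → eZ F b i a = 0) →
        0 < ∑ a ∈ A, c a * ∏ i, x i ^ (eZ F b i a).toNat := by
      rintro x hx ⟨a₀, ha₀, hta⟩
      let y : Fin r → ℝ := fun i => Real.log (x i)
      let t : Fin n → ℝ := fun l => Real.exp (∑ i, y i * F i l)
      rw [cox_eq A F b c x y t (fun _ => rfl) he
        (fun i hi => (Real.exp_log (lt_of_le_of_ne (hx i) (Ne.symm hi))).symm)]
      apply mul_pos (Real.exp_pos _)
      let w : Fin n → ℝ := fun l => ∑ i ∈ univ.filter (fun i => x i = 0), (F i l : ℝ)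
      have hw : ∀ a, dotR w (castR a) = ∑ i ∈ univ.filter (fun i => x i = 0),
          ((eZ F b i a : ℝ) - b i) := by
        intro a
        simp only [dotR, w, eZ_cast, add_sub_cancel_right, Finset.sum_mul]
        rw [Finset.sum_comm]
      have hfe : A.filter (fun a => ∀ i, x i = 0 → eZ F b i a = 0)
          = A.filter (fun a => ∀ a' ∈ A, dotR w (castR a) ≤ dotR w (castR a')) := by
        apply Finset.filter_congr
        intro a ha
        simp only [hw, Finset.sum_sub_distrib, sub_le_sub_iff_right]
        constructor
        · intro h0 a' ha'
          apply Finset.sum_le_sum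
          intro i hi
          rw [h0 i (Finset.mem_filter.1 hi).2]
          exact_mod_cast he a' ha' i
        · intro h0
          have h1 := h0 a₀ ha₀
          rw [Finset.sum_eq_zero (s := univ.filter (fun i => x i = 0))
            (f := fun i => (eZ F b i a₀ : ℝ))
            (fun i hi => by rw [hta i (Finset.mem_filter.1 hi).2]; simp)] at h1
          have hnn : ∀ i ∈ univ.filter (fun i => x i = 0), (0 : ℝ) ≤ (eZ F b i a : ℝ) :=
            fun i _ => by exact_mod_cast he a ha i
          have h2 := (Finset.sum_eq_zero_iff_of_nonneg hnn).1
            (le_antisymm h1 (Finset.sum_nonneg hnn))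
          intro i hi
          exact_mod_cast h2 i (by simp [hi])
      rw [hfe]
      exact h w t (fun l => Real.exp_pos _)
    have hzero : ∀ x : Fin r → ℝ, (¬ ∃ a ∈ A, ∀ i, x i = 0 → eZ F b i a = 0) →
        ∑ a ∈ A, c a * ∏ i, x i ^ (eZ F b i a).toNat = 0 := by
      intro x hx
      push Not at hx
      apply Finset.sum_eq_zero
      intro a ha
      obtain ⟨i, hi, hne⟩ := hx a ha
      rw [Finset.prod_eq_zero (Finset.mem_univ i), mul_zero]
      rw [hi]
      apply zero_pow
      have := he a ha i
      omega
    refine ⟨fun x hx => ?_, ?_⟩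
    · by_cases hc : ∃ a ∈ A, ∀ i, x i = 0 → eZ F b i a = 0
      · exact (hpos x hx hc).le
      · exact (hzero x hc).ge
    · ext x
      simp only [Set.mem_ofPred_eq]
      refine and_congr_right fun hx => ⟨fun h0 hc => ?_, hzero x⟩
      exact (hpos x hx hc).ne' h0
  · rintro ⟨hnn, hset⟩ w t ht
    set G := A.filter (fun a => ∀ a' ∈ A, dotR w (castR a) ≤ dotR w (castR a')) with hG
    obtain ⟨y, hy⟩ := span_F A hA F b hFb (fun l => Real.log (t l))
    let x : Fin r → ℝ := fun i => if ∀ a ∈ G, eZ F b i a = 0 then 0 else Real.exp (y i)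
    have hx0 : ∀ i, x i = 0 ↔ ∀ a ∈ G, eZ F b i a = 0 := by
      intro i
      simp only [x]
      split_ifs with h
      · simpa using h
      · simp only [Real.exp_ne_zero, false_iff]; exact h
    have hxn : ∀ i, 0 ≤ x i := by
      intro i
      simp only [x]
      split_ifs
      · exact le_rfl
      · exact (Real.exp_pos _).le
    obtain ⟨⟨g, hg⟩, hface⟩ := face_eq A hA F b hFb he w G hG (fun i => x i = 0) hx0
    have hcox := cox_eq A F b c x y t
      (fun l => by rw [← hy l, Real.exp_log (ht l)]) he
      (fun i hi => by
        have : ¬ ∀ a ∈ G, eZ F b i a = 0 := fun h => hi ((hx0 i).2 h)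
        simp only [x]
        rw [if_neg this])
    rw [hface] at hcox
    have hge := hnn x hxn
    have hne : ∑ a ∈ A, c a * ∏ i, x i ^ (eZ F b i a).toNat ≠ 0 := by
      intro h0
      have hm := hset.subset (show x ∈ _ from ⟨hxn, h0⟩)
      refine hm.2 ⟨g, ?_, fun i hi => (hx0 i).1 hi g hg⟩
      rw [hG] at hg
      exact (Finset.mem_filter.1 hg).1
    have hpos := lt_of_le_of_ne hge hne.symm
    rw [hcox] at hpos
    exact pos_of_mul_pos_right hpos (Real.exp_pos _).le
end
end

section
/- Let r, k ≥ 1 and let C₁,…,C_k ⊆ {1,…,r} be subsets with C₁ ∪ ⋯ ∪ C_k = {1,…,r}. In the polynomial ring ℝ[x₁,…,x_r], let T = {g + Σ_{j=1}^k h_j·(1 − Σ_{i∈C_j} x_i) : g a polynomial with all coefficients ≥ 0, h₁,…,h_k ∈ ℝ[x₁,…,x_r]}. Then T is Archimedean: for every f ∈ ℝ[x₁,…,x_r] there exists N ∈ ℕ such that N + f ∈ T and N − f ∈ T. -/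
open Finset MvPolynomial

noncomputable section

def PT {r k : ℕ} (C : Fin k → Finset (Fin r)) (p : MvPolynomial (Fin r) ℝ) : Prop :=
  ∃ g : MvPolynomial (Fin r) ℝ, (∀ d, 0 ≤ coeff d g) ∧
    p - g ∈ Ideal.span (Set.range fun j : Fin k =>
      (1 - ∑ i ∈ C j, X i : MvPolynomial (Fin r) ℝ))

lemma PT.out {r k : ℕ} {C : Fin k → Finset (Fin r)} {p : MvPolynomial (Fin r) ℝ}
    (hp : PT C p) : ∃ g : MvPolynomial (Fin r) ℝ, ∃ h : Fin k → MvPolynomial (Fin r) ℝ,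
        (∀ d, 0 ≤ coeff d g) ∧ p = g + ∑ j, h j * (1 - ∑ i ∈ C j, X i) := by
  obtain ⟨g, hg, hm⟩ := hp
  obtain ⟨h, hh⟩ := Ideal.mem_span_range_iff_exists_fun.1 hm
  exact ⟨g, h, hg, by rw [hh]; ring⟩

lemma PT.of_nonneg {r k : ℕ} (C : Fin k → Finset (Fin r)) {p : MvPolynomial (Fin r) ℝ}
    (hp : ∀ d, 0 ≤ coeff d p) : PT C p := ⟨p, hp, by simp⟩

lemma PT.add {r k : ℕ} {C : Fin k → Finset (Fin r)} {p q : MvPolynomial (Fin r) ℝ}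
    (hp : PT C p) (hq : PT C q) : PT C (p + q) := by
  obtain ⟨g, hg, hm⟩ := hp
  obtain ⟨g', hg', hm'⟩ := hq
  refine ⟨g + g', fun d => ?_, ?_⟩
  · rw [coeff_add]; exact add_nonneg (hg d) (hg' d)
  · have := Ideal.add_mem _ hm hm'
    convert this using 1
    ring

lemma PT.mul {r k : ℕ} {C : Fin k → Finset (Fin r)} {p q : MvPolynomial (Fin r) ℝ}
    (hp : PT C p) (hq : PT C q) : PT C (p * q) := by
  obtain ⟨g, hg, hm⟩ := hp
  obtain ⟨g', hg', hm'⟩ := hq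
  refine ⟨g * g', fun d => ?_, ?_⟩
  · classical
    rw [coeff_mul]; exact Finset.sum_nonneg fun x _ => mul_nonneg (hg _) (hg' _)
  · have := Ideal.add_mem _ (Ideal.mul_mem_left _ q hm) (Ideal.mul_mem_left _ g hm')
    convert this using 1
    ring

lemma PT.const {r k : ℕ} (C : Fin k → Finset (Fin r)) {a : ℝ} (ha : 0 ≤ a) :
    PT C (MvPolynomial.C a) := by
  classical
  refine PT.of_nonneg C fun d => ?_
  rw [coeff_C]; split_ifs <;> simp [ha]

lemma coeff_X_nonneg' {r : ℕ} (i : Fin r) (d) :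
    0 ≤ coeff d (X i : MvPolynomial (Fin r) ℝ) := by
  classical
  rw [coeff_X']; split_ifs <;> simp

def PB {r k : ℕ} (C : Fin k → Finset (Fin r)) (f : MvPolynomial (Fin r) ℝ) : Prop :=
  ∃ N : ℕ, PT C ((N : MvPolynomial (Fin r) ℝ) + f) ∧ PT C ((N : MvPolynomial (Fin r) ℝ) - f)

lemma PB.mul {r k : ℕ} {C : Fin k → Finset (Fin r)} {p q : MvPolynomial (Fin r) ℝ}
    (hp : PB C p) (hq : PB C q) : PB C (p * q) := by
  obtain ⟨N, h1, h2⟩ := hp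
  obtain ⟨M, h3, h4⟩ := hq
  have hc : PT C (MvPolynomial.C (1/2 : ℝ)) := PT.const C (by norm_num)
  have e : (MvPolynomial.C (1/2 : ℝ) : MvPolynomial (Fin r) ℝ) * 2 = 1 := by
    rw [← map_ofNat (MvPolynomial.C : ℝ →+* MvPolynomial (Fin r) ℝ) 2, ← map_mul]
    norm_num
  refine ⟨N * M, ?_, ?_⟩
  · convert hc.mul ((h1.mul h3).add (h2.mul h4)) using 1
    push_cast
    linear_combination (-(N * M + p * q : MvPolynomial (Fin r) ℝ)) * e
  · convert hc.mul ((h1.mul h4).add (h2.mul h3)) using 1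
    push_cast
    linear_combination (-(N * M - p * q : MvPolynomial (Fin r) ℝ)) * e

lemma PB.all {r k : ℕ} (C : Fin k → Finset (Fin r))
    (hcover : ∀ i : Fin r, ∃ j, i ∈ C j) (f : MvPolynomial (Fin r) ℝ) : PB C f := by
  induction f using MvPolynomial.induction_on with
  | C a =>
    obtain ⟨N, hN⟩ := exists_nat_ge |a|
    have := abs_le.1 hN
    refine ⟨N, ?_, ?_⟩
    · rw [← map_natCast (MvPolynomial.C : ℝ →+* MvPolynomial (Fin r) ℝ) N, ← map_add]
      exact PT.const C (by linarith)
    · rw [← map_natCast (MvPolynomial.C : ℝ →+* MvPolynomial (Fin r) ℝ) N, ← map_sub]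
      exact PT.const C (by linarith)
  | add p q hp hq =>
    obtain ⟨N, h1, h2⟩ := hp
    obtain ⟨M, h3, h4⟩ := hq
    refine ⟨N + M, ?_, ?_⟩
    · convert h1.add h3 using 1
      push_cast; ring
    · convert h2.add h4 using 1
      push_cast; ring
  | mul_X p i hp =>
    refine hp.mul ⟨1, ?_, ?_⟩
    · have := (PT.const C (zero_le_one)).add (PT.of_nonneg C (coeff_X_nonneg' i))
      simpa using this
    · obtain ⟨j, hj⟩ := hcover i
      refine ⟨∑ l ∈ (C j).erase i, X l, fun d => ?_, ?_⟩
      · rw [coeff_sum]; exact Finset.sum_nonneg fun l _ => coeff_X_nonneg' l d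
      · refine Ideal.subset_span ⟨j, ?_⟩
        simp only
        rw [← Finset.add_sum_erase _ _ hj]
        push_cast; ring

/-- Proposition 4.6 (first assertion): the preprime of `ℝ[x₁,…,x_r]` generated by the
nonnegative polynomials and the ideal generated by the `1 − ∑_{i∈C_j} x_i` is
Archimedean, provided the sets `C_j` cover `{1,…,r}`. -/
theorem cox_preprime_archimedean
    {r k : ℕ} (hr : 1 ≤ r) (hk : 1 ≤ k)
    (C : Fin k → Finset (Fin r))
    (hcover : ∀ i : Fin r, ∃ j, i ∈ C j)
    (f : MvPolynomial (Fin r) ℝ) :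
    ∃ N : ℕ,
      (∃ g : MvPolynomial (Fin r) ℝ, ∃ h : Fin k → MvPolynomial (Fin r) ℝ,
        (∀ d, 0 ≤ coeff d g) ∧
        (N : MvPolynomial (Fin r) ℝ) + f =
          g + ∑ j, h j * (1 - ∑ i ∈ C j, X i)) ∧
      (∃ g : MvPolynomial (Fin r) ℝ, ∃ h : Fin k → MvPolynomial (Fin r) ℝ,
        (∀ d, 0 ≤ coeff d g) ∧
        (N : MvPolynomial (Fin r) ℝ) - f =
          g + ∑ j, h j * (1 - ∑ i ∈ C j, X i)) := by
  obtain ⟨N, h1, h2⟩ := PB.all C hcover f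
  exact ⟨N, h1.out, h2.out⟩
end
end

section
/- Let A ⊆ ℤⁿ be a finite set with conv(A) of affine dimension n, and let F₁,…,F_r ∈ ℤⁿ, b ∈ ℤ^r satisfy conv(A) = {p ∈ ℝⁿ : ⟨F_i,p⟩ + b_i ≥ 0 ∀i}. Let C₁,…,C_k ⊆ {1,…,r} be subsets such that C₁ ∪ ⋯ ∪ C_k = {1,…,r} and such that {x ∈ ℝ^r_{≥0} : for every extreme point v of conv(A), ∏_{i:⟨F_i,v⟩+b_i>0} x_i = 0} ⊆ ⋃_{j=1}^k {x ∈ ℝ^r_{≥0} : x_i = 0 for all i ∈ C_j}. Let f = Σ_{a∈A} c_a t^a with supp(f) ⊆ A be strictly A-copositive, i.e. for every w ∈ ℝⁿ the truncation Σ_{a∈A, ⟨w,a⟩ minimal over A} c_a t^a is strictly positive on ℝⁿ_{>0}. Then there exist a polynomial g ∈ ℝ[x₁,…,x_r] with all coefficients nonnegative and polynomials g₁,…,g_k ∈ ℝ[x₁,…,x_r] such that f_cox = g + Σ_{j=1}^k g_j·(1 − Σ_{i∈C_j} x_i), where f_cox(x) = Σ_{a∈A} c_a ∏_i x_i^{⟨F_i,a⟩+b_i}.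 -/
open Finset MvPolynomial
open scoped Classical

noncomputable section

/-- The Cox homogenization of `f = ∑_{a∈A} c_a t^a` as a polynomial in `ℝ[x₁,…,x_r]`. -/
def coxHom {n r : ℕ} (A : Finset (Fin n → ℤ)) (F : Fin r → Fin n → ℤ)
    (b : Fin r → ℤ) (c : (Fin n → ℤ) → ℝ) : MvPolynomial (Fin r) ℝ :=
  ∑ a ∈ A, monomial
    (Finsupp.equivFunOnFinite.symm fun i => ((∑ l, F i l * a l) + b i).toNat) (c a)

theorem kd_aux_state {R : Type*} [CommRing R] [Algebra ℝ R] (T : Set R)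
    (hadd : ∀ a ∈ T, ∀ b ∈ T, a + b ∈ T) (hmul : ∀ a ∈ T, ∀ b ∈ T, a * b ∈ T)
    (hC : ∀ s : ℝ, 0 ≤ s → algebraMap ℝ R s ∈ T)
    (harch : ∀ a : R, ∃ N : ℝ, 0 ≤ N ∧ algebraMap ℝ R N + a ∈ T)
    (f : R) (hfT : f ∉ T) :
    ∃ L : R →ₗ[ℝ] ℝ, (∀ t ∈ T, 0 ≤ L t) ∧ L 1 = 1 ∧ L f ≤ 0 := by
  have hsm : ∀ s : ℝ, 0 ≤ s → ∀ a ∈ T, s • a ∈ T := by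
    intro s hs a ha
    rw [Algebra.smul_def]
    exact hmul _ (hC s hs) _ ha
  have h0 : (0 : R) ∈ T := by simpa using hC 0 le_rfl
  have h1 : (1 : R) ∈ T := by simpa using hC 1 zero_le_one
  have hm1 : (-1 : R) ∉ T := by
    intro h
    obtain ⟨N, hN, hNf⟩ := harch f
    apply hfT
    have := hadd _ hNf _ (hsm N hN _ h)
    rw [Algebra.smul_def] at this
    convert this using 1
    ring
  let K : PointedCone ℝ R :=
    { carrier := {x | ∃ t ∈ T, ∃ s : ℝ, 0 ≤ s ∧ x = t - s • f}
      add_mem' := by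
        rintro x y ⟨t, ht, s, hs, rfl⟩ ⟨t', ht', s', hs', rfl⟩
        exact ⟨t + t', hadd _ ht _ ht', s + s', add_nonneg hs hs', by rw [add_smul]; abel⟩
      zero_mem' := ⟨0, h0, 0, le_rfl, by simp⟩
      smul_mem' := by
        rintro ⟨q, hq⟩ x ⟨t, ht, s, hs, rfl⟩
        refine ⟨q • t, hsm q hq t ht, q * s, mul_nonneg hq hs, ?_⟩
        change q • (t - s • f) = _
        rw [smul_sub, mul_smul] }
  have hTK : ∀ t ∈ T, t ∈ K := fun t ht => ⟨t, ht, 0, le_rfl, by simp⟩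
  have hneg : ∀ s : ℝ, (s • (1 : R)) ∈ K → 0 ≤ s := by
    rintro s ⟨t, ht, u, hu, he⟩
    by_contra hs
    push Not at hs
    rcases hu.eq_or_lt with rfl | hu
    · apply hm1
      have : (-1 : R) = (-s)⁻¹ • t := by
        have : t = s • (1 : R) := by rw [he]; simp
        rw [this, smul_smul]
        have : (-s)⁻¹ * s = -1 := by field_simp [hs.ne]
        rw [this]; simp
      rw [this]
      exact hsm _ (by simpa using hs.le) _ ht
    · apply hfT
      have : f = u⁻¹ • (t + (-s) • (1 : R)) := by
        have : t + (-s) • (1 : R) = u • f := by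
          rw [neg_smul, he]; abel
        rw [this, smul_smul, inv_mul_cancel₀ hu.ne', one_smul]
      rw [this]
      exact hsm _ (by positivity) _ (hadd _ ht _ (hsm _ (by linarith) _ h1))
  have hne : (1 : R) ≠ 0 := by
    intro h
    apply hm1
    rw [h, neg_zero]
    exact h0
  let φ : R →ₗ.[ℝ] ℝ := LinearPMap.mkSpanSingleton (1 : R) (1 : ℝ) hne
  obtain ⟨L, hL, hLK⟩ := riesz_extension K φ (by
      rintro ⟨x, hx⟩ hxK
      obtain ⟨s, rfl⟩ := Submodule.mem_span_singleton.1 hx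
      have := hneg s hxK
      erw [LinearPMap.mkSpanSingleton'_apply]
      simpa using this) (by
      intro y
      obtain ⟨N, hN, h⟩ := harch y
      refine ⟨⟨N • 1, Submodule.mem_span_singleton.2 ⟨N, rfl⟩⟩, hTK _ ?_⟩
      simpa [Algebra.smul_def] using h)
  refine ⟨L, fun t ht => hLK t (hTK t ht), ?_, ?_⟩
  · have := hL ⟨1, Submodule.mem_span_singleton_self 1⟩
    rw [this]
    exact LinearPMap.mkSpanSingleton'_apply_self _ _ _ _
  · have := hLK (-f) ⟨0, h0, 1, zero_le_one, by simp⟩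
    simpa using this

theorem kd_representation {R : Type*} [CommRing R] [Algebra ℝ R] (T : Set R)
    (hadd : ∀ a ∈ T, ∀ b ∈ T, a + b ∈ T) (hmul : ∀ a ∈ T, ∀ b ∈ T, a * b ∈ T)
    (hC : ∀ s : ℝ, 0 ≤ s → algebraMap ℝ R s ∈ T)
    (harch : ∀ a : R, ∃ N : ℝ, 0 ≤ N ∧ algebraMap ℝ R N + a ∈ T)
    (f : R) (hf : ∀ φ : R →ₐ[ℝ] ℝ, (∀ t ∈ T, 0 ≤ φ t) → 0 < φ f) : f ∈ T := by
  by_contra hfT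
  obtain ⟨L₀, hL₀T, hL₀1, hL₀f⟩ := kd_aux_state T hadd hmul hC harch f hfT
  let S : Set (R → ℝ) := {L | (∀ a b, L (a + b) = L a + L b) ∧ (∀ (s : ℝ) a, L (s • a) = s * L a) ∧
    (∀ t ∈ T, 0 ≤ L t) ∧ L 1 = 1}
  have hSc : IsClosed S := by
    have e : S = (⋂ a, ⋂ b, {L : R → ℝ | L (a + b) = L a + L b}) ∩
        ((⋂ s : ℝ, ⋂ a, {L : R → ℝ | L (s • a) = s * L a}) ∩
        ((⋂ t ∈ T, {L : R → ℝ | 0 ≤ L t}) ∩ {L : R → ℝ | L 1 = 1})) := by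
      ext L; simp [S]
    rw [e]
    refine IsClosed.inter ?_ (IsClosed.inter ?_ (IsClosed.inter ?_ ?_))
    · exact isClosed_iInter fun a => isClosed_iInter fun b =>
        isClosed_eq (by fun_prop) (by fun_prop)
    · exact isClosed_iInter fun a => isClosed_iInter fun b =>
        isClosed_eq (by fun_prop) (by fun_prop)
    · exact isClosed_iInter fun a => isClosed_iInter fun b =>
        isClosed_le (by fun_prop) (by fun_prop)
    · exact isClosed_eq (by fun_prop) (by fun_prop)
  choose N hN0 hN using harch
  have hb : ∀ L ∈ S, ∀ a, -N a ≤ L a := by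
    rintro L ⟨h1, h2, h3, h4⟩ a
    have := h3 _ (hN a)
    rw [h1, Algebra.algebraMap_eq_smul_one, h2, h4] at this
    linarith
  have hng : ∀ L ∈ S, ∀ a, L (-a) = - L a := by
    rintro L ⟨h1, h2, h3, h4⟩ a
    have := h2 (-1) a
    simpa using this
  have hScomp : IsCompact S := by
    refine IsCompact.of_isClosed_subset
      (isCompact_univ_pi (fun a : R => isCompact_Icc (a := -N a) (b := N (-a)))) hSc ?_
    intro L hL a _
    refine ⟨hb L hL a, ?_⟩
    have := hb L hL (-a)
    rw [hng L hL] at this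
    linarith
  have hL₀S : (L₀ : R → ℝ) ∈ S := ⟨by simp, by simp, hL₀T, hL₀1⟩
  obtain ⟨L₁, hL₁, hmin⟩ := hScomp.exists_isMinOn ⟨_, hL₀S⟩
    (f := fun L => L f) (by fun_prop)
  let S' : Set (R → ℝ) := S ∩ {L | L f = L₁ f}
  have hS' : IsCompact S' := hScomp.inter_right (isClosed_eq (by fun_prop) (by fun_prop))
  obtain ⟨L, hL⟩ := hS'.extremePoints_nonempty ⟨L₁, hL₁, rfl⟩
  have hex : IsExtreme ℝ S S' := by
    refine ⟨fun x hx => hx.1, ?_⟩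
    rintro x hx y hy z ⟨hz, hzf⟩ ⟨p, q, hp, hq, hpq, rfl⟩
    refine ⟨hx, ?_⟩
    have hx' : L₁ f ≤ x f := hmin hx
    have hy' : L₁ f ≤ y f := hmin hy
    simp only [Set.mem_ofPred_eq, Pi.add_apply, Pi.smul_apply, smul_eq_mul] at hzf ⊢
    have : q = 1 - p := by linarith
    subst this
    nlinarith
  have hLf : L f ≤ 0 := by
    have h1 : L f = L₁ f := hL.1.2
    have h2 : L₁ f ≤ L₀ f := hmin hL₀S
    linarith
  have hLS := hL.1.1
  have hLex := hex.extremePoints_subset_extremePoints hL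
  obtain ⟨h1, h2, h3, h4⟩ := id hLS
  have hsub : ∀ a b, L (a - b) = L a - L b := by
    intro a b
    rw [sub_eq_add_neg, h1, hng L hLS]; ring
  -- key multiplicativity
  have key : ∀ u : R, u ∈ T → 1 - u ∈ T → 0 < L u → 0 < 1 - L u → ∀ a, L (u * a) = L u * L a := by
    intro u hu hu' hp hq a
    have hst : ∀ v ∈ T, 0 < L v → (fun a => (L v)⁻¹ * L (v * a)) ∈ S := by
      intro v hv hvp
      refine ⟨fun a b => ?_, fun s a => ?_, fun t ht => ?_, ?_⟩
      · simp only [mul_add, h1]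
      · simp only [mul_smul_comm, h2]; ring
      · exact mul_nonneg (by positivity) (h3 _ (hmul _ hv _ ht))
      · simp only [mul_one]; exact inv_mul_cancel₀ hvp.ne'
    have e1 : L (1 - u) = 1 - L u := by rw [hsub, h4]
    have hA := hst u hu hp
    have hB := hst (1 - u) hu' (by rw [e1]; exact hq)
    have := hLex.2 hA hB ⟨L u, 1 - L u, hp, hq, by ring, by
      funext a
      simp only [Pi.add_apply, Pi.smul_apply, smul_eq_mul]
      rw [e1, mul_inv_cancel_left₀ hp.ne', mul_inv_cancel_left₀ hq.ne', ← h1]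
      congr 1; ring⟩
    have : (L u)⁻¹ * L (u * a) = L a := congrFun this a
    rw [← this, mul_inv_cancel_left₀ hp.ne']
  have hmulL : ∀ a b, L (a * b) = L a * L b := by
    intro a b
    set M := N a + N (-a) + 1 with hM
    have hMp : 0 < M := by have := hN0 a; have := hN0 (-a); linarith
    have m1 : algebraMap ℝ R M + a ∈ T := by
      have := hadd _ (hN a) _ (hC (N (-a) + 1) (by have := hN0 (-a); linarith))
      convert this using 1
      rw [hM]; simp only [map_add]; ring
    have m2 : algebraMap ℝ R M - a ∈ T := by
      have := hadd _ (hN (-a)) _ (hC (N a + 1) (by have := hN0 a; linarith))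
      convert this using 1
      rw [hM]; simp only [map_add]; ring
    have hsm : ∀ s : ℝ, 0 ≤ s → ∀ a ∈ T, s • a ∈ T := by
      intro s hs a ha
      rw [Algebra.smul_def]
      exact hmul _ (hC s hs) _ ha
    have b1 := hb L hLS a
    have b2 := hb L hLS (-a)
    rw [hng L hLS] at b2
    have na := hN0 a
    have nb := hN0 (-a)
    have hu : L ((2 * M)⁻¹ • (algebraMap ℝ R M + a)) = (2 * M)⁻¹ * (M + L a) := by
      rw [h2, h1, Algebra.algebraMap_eq_smul_one, h2, h4, mul_one]
    have hlt : (2 * M)⁻¹ * (M + L a) < 1 := by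
      rw [inv_mul_lt_iff₀ (by positivity)]; linarith
    have := key ((2 * M)⁻¹ • (algebraMap ℝ R M + a)) (hsm _ (by positivity) _ m1) (by
        have e : 1 - (2 * M)⁻¹ • (algebraMap ℝ R M + a) = (2 * M)⁻¹ • (algebraMap ℝ R M - a) := by
          have : (1 : R) = (2 * M)⁻¹ • (algebraMap ℝ R M + algebraMap ℝ R M) := by
            rw [← map_add, Algebra.smul_def, ← map_mul, ← two_mul,
              inv_mul_cancel₀ (by positivity), map_one]
          nth_rewrite 1 [this]
          rw [← smul_sub]; congr 1; ring
        rw [e]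
        exact hsm _ (by positivity) _ m2) (by
        rw [hu]; exact mul_pos (by positivity) (by linarith)) (by
        rw [hu]; linarith) b
    rw [hu, smul_mul_assoc, h2, add_mul, h1, ← Algebra.smul_def, h2, mul_assoc] at this
    have := mul_left_cancel₀ (by positivity) this
    linarith
  let φ : R →ₐ[ℝ] ℝ := AlgHom.ofLinearMap
    { toFun := L, map_add' := h1, map_smul' := by simpa using h2 } h4 hmulL
  have := hf φ h3
  have : 0 < L f := this
  linarith

def coxT {r k : ℕ} (C : Fin k → Finset (Fin r)) : Set (MvPolynomial (Fin r) ℝ) :=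
  {p | ∃ g : MvPolynomial (Fin r) ℝ, ∃ g' : Fin k → MvPolynomial (Fin r) ℝ,
      (∀ d, 0 ≤ coeff d g) ∧ p = g + ∑ j, g' j * (1 - ∑ i ∈ C j, X i)}

theorem coxT_of_nonneg {r k : ℕ} (C : Fin k → Finset (Fin r)) (g : MvPolynomial (Fin r) ℝ)
    (hg : ∀ d, 0 ≤ coeff d g) : g ∈ coxT C := ⟨g, 0, hg, by simp⟩

theorem coxT_X {r k : ℕ} (C : Fin k → Finset (Fin r)) (i : Fin r) : X i ∈ coxT C := by
  refine coxT_of_nonneg C _ fun d => ?_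
  rw [coeff_X']
  split_ifs <;> simp

theorem coxT_ideal {r k : ℕ} (C : Fin k → Finset (Fin r)) (q : MvPolynomial (Fin r) ℝ) (j : Fin k) :
    q * (1 - ∑ i ∈ C j, X i) ∈ coxT C := by
  refine ⟨0, Pi.single j q, by simp, ?_⟩
  rw [zero_add, Finset.sum_eq_single j]
  · simp
  · intro i _ hi
    simp [hi]
  · simp

theorem coxT_add {r k : ℕ} (C : Fin k → Finset (Fin r)) :
    ∀ a ∈ coxT C, ∀ b ∈ coxT C, a + b ∈ coxT C := by
  rintro _ ⟨g, g', hg, rfl⟩ _ ⟨h, h', hh, rfl⟩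
  refine ⟨g + h, g' + h', fun d => ?_, ?_⟩
  · rw [coeff_add]; exact add_nonneg (hg d) (hh d)
  · simp only [Pi.add_apply, add_mul, Finset.sum_add_distrib]; ring

theorem coxT_mul {r k : ℕ} (C : Fin k → Finset (Fin r)) :
    ∀ a ∈ coxT C, ∀ b ∈ coxT C, a * b ∈ coxT C := by
  rintro _ ⟨g, g', hg, rfl⟩ q ⟨h, h', hh, hq⟩
  refine ⟨g * h, fun j => g' j * q + g * h' j, fun d => ?_, ?_⟩
  · rw [coeff_mul]; exact Finset.sum_nonneg fun p _ => mul_nonneg (hg _) (hh _)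
  · have e : ∑ j, (g' j * q + g * h' j) * (1 - ∑ i ∈ C j, X i) =
        (∑ j, g' j * (1 - ∑ i ∈ C j, X i)) * q + g * ∑ j, h' j * (1 - ∑ i ∈ C j, X i) := by
      rw [Finset.sum_mul, Finset.mul_sum, ← Finset.sum_add_distrib]
      exact Finset.sum_congr rfl fun j _ => by ring
    rw [e, add_mul]
    nth_rewrite 1 [hq]
    ring

theorem coxT_C {r k : ℕ} (C : Fin k → Finset (Fin r)) (s : ℝ) (hs : 0 ≤ s) :
    algebraMap ℝ (MvPolynomial (Fin r) ℝ) s ∈ coxT C := by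
  refine coxT_of_nonneg C _ fun d => ?_
  rw [algebraMap_eq, coeff_C]
  split_ifs <;> simp [hs]

theorem coxT_sum {r k : ℕ} (C : Fin k → Finset (Fin r)) (s : Finset (Fin r)) :
    ∑ i ∈ s, (X i : MvPolynomial (Fin r) ℝ) ∈ coxT C := by
  induction s using Finset.induction_on with
  | empty => simpa using coxT_C C 0 le_rfl
  | insert a s ha ih => rw [Finset.sum_insert ha]; exact coxT_add C _ (coxT_X C a) _ ih

theorem coxT_arch {r k : ℕ} (C : Fin k → Finset (Fin r)) (hcover : ∀ i : Fin r, ∃ j, i ∈ C j)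
    (a : MvPolynomial (Fin r) ℝ) :
    ∃ N : ℝ, 0 ≤ N ∧ algebraMap ℝ _ N + a ∈ coxT C ∧ algebraMap ℝ _ N - a ∈ coxT C := by
  have hmulc : ∀ p q : MvPolynomial (Fin r) ℝ,
      (∃ N : ℝ, 0 ≤ N ∧ algebraMap ℝ _ N + p ∈ coxT C ∧ algebraMap ℝ _ N - p ∈ coxT C) →
      (∃ N : ℝ, 0 ≤ N ∧ algebraMap ℝ _ N + q ∈ coxT C ∧ algebraMap ℝ _ N - q ∈ coxT C) →
      ∃ N : ℝ, 0 ≤ N ∧ algebraMap ℝ _ N + p * q ∈ coxT C ∧ algebraMap ℝ _ N - p * q ∈ coxT C := by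
    rintro p q ⟨N, hN, h1, h2⟩ ⟨M, hM, h3, h4⟩
    have hh : algebraMap ℝ (MvPolynomial (Fin r) ℝ) (1/2) * 2 = 1 := by
      have : (2 : MvPolynomial (Fin r) ℝ) = algebraMap ℝ _ 2 := (map_ofNat _ 2).symm
      rw [this, ← map_mul]; norm_num
    refine ⟨N * M, mul_nonneg hN hM, ?_, ?_⟩
    · have := coxT_mul C _ (coxT_C C (1/2) (by norm_num)) _
        (coxT_add C _ (coxT_mul C _ h1 _ h3) _ (coxT_mul C _ h2 _ h4))
      convert this using 1
      rw [map_mul]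
      linear_combination (-(algebraMap ℝ _ N * algebraMap ℝ _ M + p * q)) * hh
    · have := coxT_mul C _ (coxT_C C (1/2) (by norm_num)) _
        (coxT_add C _ (coxT_mul C _ h1 _ h4) _ (coxT_mul C _ h2 _ h3))
      convert this using 1
      rw [map_mul]
      linear_combination (-(algebraMap ℝ _ N * algebraMap ℝ _ M - p * q)) * hh
  induction a using MvPolynomial.induction_on with
  | C s =>
    refine ⟨|s|, abs_nonneg s, ?_, ?_⟩
    · rw [← algebraMap_eq, ← map_add]
      exact coxT_C C _ (by linarith [neg_abs_le s])
    · rw [← algebraMap_eq, ← map_sub]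
      exact coxT_C C _ (by linarith [le_abs_self s])
  | add p q hp hq =>
    obtain ⟨N, hN, h1, h2⟩ := hp
    obtain ⟨M, hM, h3, h4⟩ := hq
    refine ⟨N + M, add_nonneg hN hM, ?_, ?_⟩
    · convert coxT_add C _ h1 _ h3 using 1
      rw [map_add]; ring
    · convert coxT_add C _ h2 _ h4 using 1
      rw [map_add]; ring
  | mul_X p i hp =>
    refine hmulc p (X i) hp ⟨1, zero_le_one, ?_, ?_⟩
    · exact coxT_add C _ (coxT_C C 1 zero_le_one) _ (coxT_X C i)
    · obtain ⟨j, hj⟩ := hcover i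
      convert coxT_add C _ (coxT_ideal C 1 j) _ (coxT_sum C ((C j).erase i)) using 1
      rw [← Finset.add_sum_erase _ _ hj, map_one]; ring

theorem cox_pos
    {n r k : ℕ} (A : Finset (Fin n → ℤ))
    (F : Fin r → Fin n → ℤ) (b : Fin r → ℤ)
    (hFb : convexHull ℝ (castR '' (A : Set (Fin n → ℤ))) =
      {p : Fin n → ℝ | ∀ i, 0 ≤ (∑ l, (F i l : ℝ) * p l) + (b i : ℝ)})
    (C : Fin k → Finset (Fin r))
    (hZ : {x : Fin r → ℝ | (∀ i, 0 ≤ x i) ∧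
        ∀ v ∈ Set.extremePoints ℝ (convexHull ℝ (castR '' (A : Set (Fin n → ℤ)))),
          (∏ i ∈ univ.filter (fun i => 0 < (∑ l, (F i l : ℝ) * v l) + (b i : ℝ)),
            x i) = 0} ⊆
      ⋃ j : Fin k, {x : Fin r → ℝ | (∀ i, 0 ≤ x i) ∧ ∀ i ∈ C j, x i = 0})
    (c : (Fin n → ℤ) → ℝ)
    (hf : ∀ w : Fin n → ℝ, ∀ t : Fin n → ℝ, (∀ i, 0 < t i) →
      0 < ∑ a ∈ A.filter (fun a => ∀ a' ∈ A, dotR w (castR a) ≤ dotR w (castR a')),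
            c a * ∏ i, t i ^ (a i))
    (x : Fin r → ℝ) (hx : ∀ i, 0 ≤ x i) (hxC : ∀ j, ∑ i ∈ C j, x i = 1) :
    0 < eval x (coxHom A F b c) := by
  set D : Fin r → (Fin n → ℤ) → ℤ := fun i a => (∑ l, F i l * a l) + b i with hD
  have hDc : ∀ i a, (∑ l, (F i l : ℝ) * castR a l) + (b i : ℝ) = (D i a : ℝ) := by
    intro i a; simp [hD, castR]
  have hD0 : ∀ a ∈ A, ∀ i, 0 ≤ D i a := by
    intro a ha i
    have : castR a ∈ convexHull ℝ (castR '' (A : Set (Fin n → ℤ))) :=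
      subset_convexHull ℝ _ ⟨a, ha, rfl⟩
    rw [hFb] at this
    have := this i
    rw [hDc] at this
    exact_mod_cast this
  obtain ⟨a₀, ha₀, hz⟩ : ∃ a₀ ∈ A, ∀ i, x i = 0 → D i a₀ = 0 := by
    by_contra hcon
    push Not at hcon
    have hmem := hZ (a := x) ⟨hx, by
      intro v hv
      obtain ⟨a, ha, rfl⟩ := extremePoints_convexHull_subset hv
      obtain ⟨i, hi, hDi⟩ := hcon a ha
      refine Finset.prod_eq_zero (i := i) ?_ hi
      rw [Finset.mem_filter, hDc]
      refine ⟨Finset.mem_univ _, ?_⟩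
      have := lt_of_le_of_ne (hD0 a ha i) (Ne.symm hDi)
      exact_mod_cast this⟩
    rw [Set.mem_iUnion] at hmem
    obtain ⟨j, _, hj⟩ := hmem
    have := hxC j
    rw [Finset.sum_eq_zero hj] at this
    exact zero_ne_one this
  set S : Finset (Fin r) := univ.filter (fun i => x i = 0) with hS
  set w : Fin n → ℝ := fun l => ∑ i ∈ S, (F i l : ℝ) with hw
  have hdot : ∀ a, dotR w (castR a) = ((∑ i ∈ S, D i a : ℤ) : ℝ) - ∑ i ∈ S, (b i : ℝ) := by
    intro a
    push_cast
    rw [← Finset.sum_sub_distrib]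
    simp only [← hDc, add_sub_cancel_right]
    simp only [dotR, hw, Finset.sum_mul]
    exact Finset.sum_comm
  have hfilter : A.filter (fun a => ∀ a' ∈ A, dotR w (castR a) ≤ dotR w (castR a')) =
      A.filter (fun a => ∀ i, x i = 0 → D i a = 0) := by
    refine Finset.filter_congr fun a ha => ?_
    simp only [hdot, sub_le_sub_iff_right, Int.cast_le]
    constructor
    · intro h
      have h1 := h a₀ ha₀
      have h2 : ∑ i ∈ S, D i a₀ = 0 :=
        Finset.sum_eq_zero fun i hi => hz i (Finset.mem_filter.1 hi).2
      have h3 : ∑ i ∈ S, D i a = 0 :=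
        le_antisymm (h2 ▸ h1) (Finset.sum_nonneg fun i _ => hD0 a ha i)
      rw [Finset.sum_eq_zero_iff_of_nonneg (fun i _ => hD0 a ha i)] at h3
      intro i hi
      exact h3 i (Finset.mem_filter.2 ⟨Finset.mem_univ _, hi⟩)
    · intro h a' ha'
      rw [Finset.sum_eq_zero fun i hi => h i (Finset.mem_filter.1 hi).2]
      exact Finset.sum_nonneg fun i _ => hD0 a' ha' i
  set y : Fin r → ℝ := fun i => if x i = 0 then 1 else x i with hy
  have hypos : ∀ i, 0 < y i := by
    intro i
    simp only [hy]
    split_ifs with h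
    · exact zero_lt_one
    · exact lt_of_le_of_ne (hx i) (Ne.symm h)
  have hmain := hf w (fun l => ∏ i, y i ^ (F i l))
    (fun l => Finset.prod_pos fun i _ => zpow_pos (hypos i) _)
  rw [hfilter] at hmain
  have heval : eval x (coxHom A F b c) = (∏ i, y i ^ (b i)) *
      ∑ a ∈ A.filter (fun a => ∀ i, x i = 0 → D i a = 0),
        c a * ∏ l, (∏ i, y i ^ (F i l)) ^ (a l) := by
    rw [Finset.sum_filter, Finset.mul_sum, coxHom, map_sum]
    refine Finset.sum_congr rfl fun a ha => ?_
    rw [eval_monomial, Finsupp.prod_fintype _ _ (fun i => pow_zero _)]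
    simp only [Finsupp.equivFunOnFinite_symm_apply_apply]
    change c a * ∏ i, x i ^ (D i a).toNat = _
    split_ifs with h
    · have e1 : ∏ i, x i ^ (D i a).toNat = ∏ i, y i ^ (D i a) := by
        refine Finset.prod_congr rfl fun i _ => ?_
        by_cases hi : x i = 0
        · simp [h i hi]
        · have : y i = x i := by simp [hy, hi]
          rw [this, ← zpow_natCast, Int.toNat_of_nonneg (hD0 a ha i)]
      have e2 : ∏ i, y i ^ (D i a) =
          (∏ i, y i ^ (b i)) * ∏ l, (∏ i, y i ^ (F i l)) ^ (a l) := by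
        simp only [← Finset.prod_zpow]
        rw [Finset.prod_comm, ← Finset.prod_mul_distrib]
        refine Finset.prod_congr rfl fun i _ => ?_
        simp only [hD, ← zpow_mul]
        rw [zpow_add₀ (hypos i).ne', mul_comm]
        congr 1
        generalize (univ : Finset (Fin n)) = s
        induction s using Finset.induction_on with
        | empty => simp
        | insert q s hq ih =>
          rw [Finset.sum_insert hq, Finset.prod_insert hq, zpow_add₀ (hypos i).ne', ih]
      rw [e1, e2]; ring
    · push Not at h
      obtain ⟨i, hi, hDi⟩ := h
      rw [mul_zero, Finset.prod_eq_zero (Finset.mem_univ i), mul_zero]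
      rw [hi]
      apply zero_pow
      have := hD0 a ha i
      omega
  rw [heval]
  exact mul_pos (Finset.prod_pos fun i _ => zpow_pos (hypos i) _) hmain

/-- Proposition 4.6 (second assertion): if the sets `C_j` cover `{1,…,r}` and the
nonnegative part of the irrelevant locus is covered by the coordinate subspaces
attached to the `C_j`, then every strictly `A`-copositive `f` admits a representation
`f_cox = g + ∑_j g_j (1 − ∑_{i∈C_j} x_i)` with `g` having nonnegative coefficients. -/
theorem strictA_copositive_cox_representation
    {n r k : ℕ} (A : Finset (Fin n → ℤ))
    (hdim : affineSpan ℝ (castR '' (A : Set (Fin n → ℤ))) = ⊤)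
    (F : Fin r → Fin n → ℤ) (b : Fin r → ℤ)
    (hFb : convexHull ℝ (castR '' (A : Set (Fin n → ℤ))) =
      {p : Fin n → ℝ | ∀ i, 0 ≤ (∑ l, (F i l : ℝ) * p l) + (b i : ℝ)})
    (C : Fin k → Finset (Fin r))
    (hcover : ∀ i : Fin r, ∃ j, i ∈ C j)
    (hZ : {x : Fin r → ℝ | (∀ i, 0 ≤ x i) ∧
        ∀ v ∈ Set.extremePoints ℝ (convexHull ℝ (castR '' (A : Set (Fin n → ℤ)))),
          (∏ i ∈ univ.filter (fun i => 0 < (∑ l, (F i l : ℝ) * v l) + (b i : ℝ)),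
            x i) = 0} ⊆
      ⋃ j : Fin k, {x : Fin r → ℝ | (∀ i, 0 ≤ x i) ∧ ∀ i ∈ C j, x i = 0})
    (c : (Fin n → ℤ) → ℝ)
    -- `f` is strictly `A`-copositive: every face truncation is positive on `ℝⁿ_{>0}`
    (hf : ∀ w : Fin n → ℝ, ∀ t : Fin n → ℝ, (∀ i, 0 < t i) →
      0 < ∑ a ∈ A.filter (fun a => ∀ a' ∈ A, dotR w (castR a) ≤ dotR w (castR a')),
            c a * ∏ i, t i ^ (a i)) :
    ∃ g : MvPolynomial (Fin r) ℝ, ∃ g' : Fin k → MvPolynomial (Fin r) ℝ,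
      (∀ d, 0 ≤ coeff d g) ∧
      coxHom A F b c = g + ∑ j, g' j * (1 - ∑ i ∈ C j, X i) := by

  have hmem : coxHom A F b c ∈ coxT C := by
    refine kd_representation (coxT C) (coxT_add C) (coxT_mul C) (coxT_C C)
      (fun a => ?_) _ fun φ hφ => ?_
    · obtain ⟨N, h0, h1, _⟩ := coxT_arch C hcover a
      exact ⟨N, h0, h1⟩
    · have e : φ = aeval (fun i => φ (X i)) := aeval_unique φ
      have e2 : φ (coxHom A F b c) = eval (fun i => φ (X i)) (coxHom A F b c) := by
        conv_lhs => rw [e]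
        rw [aeval_eq_eval]
      rw [e2]
      refine cox_pos A F b hFb C hZ c hf _ (fun i => hφ _ (coxT_X C i)) fun j => ?_
      have p1 := hφ _ (coxT_ideal C 1 j)
      have p2 := hφ _ (coxT_ideal C (-1) j)
      simp only [map_mul, map_sub, map_sum, map_one, map_neg] at p1 p2
      linarith
  exact hmem
end
end

section
/- Let k ≥ 1, let n₁,…,n_k ≥ 1 and d₁,…,d_k ≥ 1 be integers, n = n₁+⋯+n_k, and partition the coordinates {1,…,n} into blocks B₁,…,B_k with |B_j| = n_j. Let P = {p ∈ ℝⁿ : p_i ≥ 0 for all i, and Σ_{i∈B_j} p_i ≤ d_j for all j} (a product of dilated standard simplices). Let A ⊆ ℤⁿ be finite with conv(A) = P, and let f = Σ_{a∈A} c_a t^a be a real Laurent polynomial with supp(f) ⊆ A. Define f_cox ∈ ℝ[x₁,…,xₙ,y₁,…,y_k] by f_cox = Σ_{a∈A} c_a (∏_{i=1}^n x_i^{a_i}) ∏_{j=1}^k y_j^{d_j − Σ_{i∈B_j} a_i}. Then the following are equivalent: (i) for every w ∈ ℝⁿ, the truncation Σ_{a ∈ A, ⟨w,a⟩ minimal over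 conv(A)} c_a t^a is strictly positive on ℝⁿ_{>0} (f is strictly A-copositive); (ii) conv(supp f) = P and there exist N₁,…,N_k ∈ ℕ such that ∏_{j=1}^k (y_j + Σ_{i∈B_j} x_i)^{N_j} · f_cox has only nonnegative coefficients; (iii) conv(supp f) = P and there exists N ∈ ℕ such that (∏_{j=1}^k (y_j + Σ_{i∈B_j} x_i))^N · f_cox has only nonnegative coefficients. -/
open Finset MvPolynomial
open scoped Classical

noncomputable section

/-- Cox homogenization of `f = ∑_{a∈A} c_a t^a` for a product of dilated standard
simplices: the variables `x_i` are `Sum.inl i`, the slack variables `y_j` are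
`Sum.inr j`, and the exponent of `y_j` is `d_j − ∑_{i∈B_j} a_i`. -/
def coxHomProd {n k : ℕ} (A : Finset (Fin n → ℤ)) (B : Fin k → Finset (Fin n))
    (d : Fin k → ℕ) (c : (Fin n → ℤ) → ℝ) : MvPolynomial (Fin n ⊕ Fin k) ℝ :=
  ∑ a ∈ A, monomial
    (Finsupp.equivFunOnFinite.symm
      (Sum.elim (fun i => (a i).toNat) fun j => ((d j : ℤ) - ∑ i ∈ B j, a i).toNat))
    (c a)

/-- The multiplier `y_j + ∑_{i ∈ B_j} x_i` attached to the `j`-th block. -/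
def blockMul {n k : ℕ} (B : Fin k → Finset (Fin n)) (j : Fin k) :
    MvPolynomial (Fin n ⊕ Fin k) ℝ :=
  X (Sum.inr j) + ∑ i ∈ B j, X (Sum.inl i)


section PolyaAbstract
variable {σ κ : Type} [Fintype σ] [Fintype κ]

def mdeg (β : σ → κ) (u : σ →₀ ℕ) (j : κ) : ℕ := ∑ s ∈ univ.filter (fun s => β s = j), u s

def ell (β : σ → κ) (j : κ) : MvPolynomial σ ℝ := ∑ s ∈ univ.filter (fun s => β s = j), X s

lemma mdeg_add_single (β : σ → κ) (v : σ →₀ ℕ) (s : σ) (j : κ) :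
    mdeg β (v + Finsupp.single s 1) j = mdeg β v j + if β s = j then 1 else 0 := by
  unfold mdeg
  simp only [Finsupp.add_apply, Finset.sum_add_distrib, Finsupp.single_apply]
  congr 1
  rw [Finset.sum_ite_eq]
  simp

def PInv (β : σ → κ) (e : σ →₀ ℕ) (H : MvPolynomial σ ℝ) (M : κ → ℕ) : Prop :=
  ∀ u : σ →₀ ℕ, coeff u H * ((∏ s, (u s).factorial : ℕ) : ℝ) =
    if (∀ j, mdeg β u j = M j + mdeg β e j) then
      ((∏ j, (M j).factorial : ℕ) : ℝ) * ((∏ s, (u s).descFactorial (e s) : ℕ) : ℝ) else 0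

lemma PInv_base (β : σ → κ) (e : σ →₀ ℕ) : PInv β e (monomial e 1) 0 := by
  intro u
  rw [coeff_monomial]
  by_cases h : e = u
  · subst h
    simp [Nat.descFactorial_self]
  · rw [if_neg h, zero_mul]
    split_ifs with h1
    · symm
      apply mul_eq_zero_of_right
      norm_cast
      rw [Finset.prod_eq_zero_iff]
      by_contra h2
      push Not at h2
      have h3 : ∀ s, e s ≤ u s := by
        intro s
        have := h2 s (mem_univ s)
        rw [Ne, Nat.descFactorial_eq_zero_iff_lt] at this
        omega
      apply h
      ext s
      have h4 := h1 (β s)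
      simp only [Pi.zero_apply, zero_add] at h4
      unfold mdeg at h4
      exact (Finset.sum_eq_sum_iff_of_le (fun i _ => h3 i)).1 h4.symm s (by simp)
    · rfl

lemma desc_aux (u e : ℕ) : (((u+1 : ℕ) : ℝ)) * ((u.descFactorial e : ℕ) : ℝ) =
    (((u+1 : ℕ) : ℝ) - e) * (((u+1).descFactorial e : ℕ) : ℝ) := by
  have h := Nat.succ_descFactorial u e
  rcases le_or_gt e (u+1) with h1 | h1
  · rw [← Nat.cast_sub h1]
    exact_mod_cast h.symm
  · have h2 : u.descFactorial e = 0 := by rw [Nat.descFactorial_eq_zero_iff_lt]; omega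
    have h3 : (u+1).descFactorial e = 0 := by rw [Nat.descFactorial_eq_zero_iff_lt]; omega
    simp [h2, h3]

lemma PInv_term (β : σ → κ) (e : σ →₀ ℕ) (H : MvPolynomial σ ℝ) (M : κ → ℕ) (h : PInv β e H M)
    (j : κ) (s : σ) (hs : β s = j) (u : σ →₀ ℕ) :
    coeff u (X s * H) * ((∏ s, (u s).factorial : ℕ) : ℝ) =
    if (∀ i, mdeg β u i = (M i + if j = i then 1 else 0) + mdeg β e i) then
      ((∏ j, (M j).factorial : ℕ) : ℝ) * (((u s : ℝ) - e s) *
        ((∏ s, (u s).descFactorial (e s) : ℕ) : ℝ)) else 0 := by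
  rw [coeff_X_mul']
  by_cases hu : s ∈ u.support
  · rw [if_pos hu]
    obtain ⟨v, rfl⟩ : ∃ v, u = v + Finsupp.single s 1 := by
      refine ⟨u - Finsupp.single s 1, ?_⟩
      rw [tsub_add_cancel_of_le]
      rw [Finsupp.single_le_iff]
      simp at hu; omega
    rw [add_tsub_cancel_right]
    have hv := h v
    have hc : (∀ i, mdeg β (v + Finsupp.single s 1) i = (M i + if j = i then 1 else 0) + mdeg β e i)
        ↔ (∀ i, mdeg β v i = M i + mdeg β e i) := by
      apply forall_congr'
      intro i
      rw [mdeg_add_single, hs]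
      constructor <;> intro h <;> omega
    have hf : ((∏ t, ((v + Finsupp.single s 1 : σ →₀ ℕ) t).factorial : ℕ) : ℝ) =
        ((v s + 1 : ℕ) : ℝ) * ((∏ t, (v t).factorial : ℕ) : ℝ) := by
      norm_cast
      rw [← Finset.mul_prod_erase univ _ (mem_univ s),
        ← Finset.mul_prod_erase univ (fun t => (v t).factorial) (mem_univ s), ← mul_assoc]
      congr 1
      · simp [Nat.factorial_succ]
      · apply Finset.prod_congr rfl
        intro t ht
        have : s ≠ t := by simp at ht; tauto
        simp [Finsupp.single_apply, this]
    have hg : (((v + Finsupp.single s 1 : σ →₀ ℕ) s : ℕ) - e s : ℝ) *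
          ((∏ t, ((v + Finsupp.single s 1 : σ →₀ ℕ) t).descFactorial (e t) : ℕ) : ℝ) =
        ((v s + 1 : ℕ) : ℝ) * ((∏ t, (v t).descFactorial (e t) : ℕ) : ℝ) := by
      rw [← Finset.mul_prod_erase univ _ (mem_univ s),
        ← Finset.mul_prod_erase univ (fun t => (v t).descFactorial (e t)) (mem_univ s)]
      rw [Nat.cast_mul, Nat.cast_mul, ← mul_assoc, ← mul_assoc]
      congr 1
      · rw [desc_aux]
        simp
      · congr 1
        apply Finset.prod_congr rfl
        intro t ht
        have : s ≠ t := by simp at ht; tauto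
        simp [Finsupp.single_apply, this]
    rw [hf, hg]
    simp only [hc]
    rw [mul_left_comm, hv]
    split_ifs
    · ring
    · simp
  · rw [if_neg hu, zero_mul]
    split_ifs
    · simp at hu
      symm
      rcases Nat.eq_zero_or_pos (e s) with h0 | h0
      · simp [hu, h0]
      · have : ∏ s, (u s).descFactorial (e s) = 0 := by
          apply Finset.prod_eq_zero (mem_univ s)
          rw [Nat.descFactorial_eq_zero_iff_lt]; omega
        simp [this]
    · rfl

lemma PInv_step (β : σ → κ) (e : σ →₀ ℕ) (H : MvPolynomial σ ℝ) (M : κ → ℕ) (h : PInv β e H M)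
    (j : κ) : PInv β e (ell β j * H) (fun i => M i + if j = i then 1 else 0) := by
  intro u
  unfold ell
  rw [Finset.sum_mul, coeff_sum, Finset.sum_mul]
  rw [Finset.sum_congr rfl (fun s hs => PInv_term β e H M h j s (by simpa using hs) u)]
  split_ifs with hc
  · rw [← Finset.mul_sum, ← Finset.sum_mul, Finset.sum_sub_distrib, ← mul_assoc]
    congr 1
    have h1 := hc j
    unfold mdeg at h1
    have h2 : (∑ s ∈ univ.filter (fun s => β s = j), (u s : ℝ)) -
        ∑ s ∈ univ.filter (fun s => β s = j), (e s : ℝ) = M j + 1 := by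
      rw [← Nat.cast_sum, ← Nat.cast_sum, h1]
      simp
    rw [h2]
    norm_cast
    rw [← Finset.mul_prod_erase univ _ (mem_univ j),
        ← Finset.mul_prod_erase univ (fun i => (M i + if j = i then 1 else 0).factorial) (mem_univ j)]
    rw [mul_comm _ (M j + 1), ← mul_assoc]
    congr 1
    · simp [Nat.factorial_succ]
    · apply Finset.prod_congr rfl
      intro t ht
      have : j ≠ t := by simp at ht; tauto
      simp [this]
  · simp

lemma PInv_pow (β : σ → κ) (e : σ →₀ ℕ) (H : MvPolynomial σ ℝ) (M : κ → ℕ) (h : PInv β e H M)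
    (j : κ) (N : ℕ) : PInv β e (ell β j ^ N * H) (fun i => M i + if j = i then N else 0) := by
  induction N with
  | zero => simpa using h
  | succ N ih =>
    have := PInv_step β e _ _ ih j
    rw [← mul_assoc, ← pow_succ'] at this
    convert this using 1
    funext i
    split_ifs <;> omega

lemma PInv_all (β : σ → κ) (e : σ →₀ ℕ) (N : ℕ) :
    PInv β e ((∏ j, ell β j) ^ N * monomial e 1) (fun _ => N) := by
  have key : ∀ S : Finset κ, PInv β e ((∏ j ∈ S, ell β j ^ N) * monomial e 1)
      (fun j => if j ∈ S then N else 0) := by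
    intro S
    induction S using Finset.induction_on with
    | empty =>
      have := PInv_base β e
      simp only [Finset.prod_empty, one_mul, Finset.notMem_empty, if_false]
      exact this
    | insert j S hj ih =>
      have := PInv_pow β e _ _ ih j N
      rw [Finset.prod_insert hj, mul_assoc]
      convert this using 1
      funext i
      by_cases h : j = i
      · subst h; simp [hj]
      · simp [h, Ne.symm h]
  have := key univ
  simpa [Finset.prod_pow] using this

lemma desc_tendsto (u : ℕ → ℕ) (D : ℕ → ℝ) (hD : Filter.Tendsto D Filter.atTop Filter.atTop)
    (x : ℝ) (h : Filter.Tendsto (fun m => (u m : ℝ) / D m) Filter.atTop (nhds x)) (e : ℕ) :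
    Filter.Tendsto (fun m => ((u m).descFactorial e : ℝ) / D m ^ e) Filter.atTop (nhds (x ^ e)) := by
  induction e with
  | zero => simp
  | succ e ih =>
    have h1 : Filter.Tendsto (fun m => (u m : ℝ) / D m - e / D m) Filter.atTop (nhds x) := by
      simpa using h.sub (hD.const_div_atTop (e : ℝ))
    have h2 := h1.mul ih
    rw [← pow_succ'] at h2
    refine h2.congr fun m => ?_
    have : ((u m).descFactorial (e+1) : ℝ) = ((u m : ℝ) - e) * ((u m).descFactorial e : ℝ) := by
      rw [Nat.descFactorial_succ]
      rcases le_or_gt e (u m) with h | h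
      · rw [Nat.cast_mul, Nat.cast_sub h]
      · have : (u m).descFactorial e = 0 := by rw [Nat.descFactorial_eq_zero_iff_lt]; exact h
        simp [this]
    rw [this, ← sub_div, pow_succ', mul_div_mul_comm]

lemma polya_abstract {ι : Type} (β : σ → κ) (A : Finset ι) (E : ι → σ →₀ ℕ) (c : ι → ℝ) (d : κ → ℕ)
    (hE : ∀ a ∈ A, ∀ j, mdeg β (E a) j = d j)
    (hpos : ∀ x : σ → ℝ, (∀ s, 0 ≤ x s) →
      (∀ j, ∑ s ∈ univ.filter (fun s => β s = j), x s = 1) → 0 < ∑ a ∈ A, c a * ∏ s, x s ^ (E a s)) :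
    ∃ N : ℕ, ∀ e, 0 ≤ coeff e ((∏ j, ell β j) ^ N * ∑ a ∈ A, monomial (E a) (c a)) := by
  by_contra hcon
  push Not at hcon
  choose U hU using hcon
  have formula : ∀ N u, coeff u ((∏ j, ell β j) ^ N * ∑ a ∈ A, monomial (E a) (c a)) *
      ((∏ s, (u s).factorial : ℕ) : ℝ) =
      if (∀ j, mdeg β u j = N + d j) then
      ((∏ j : κ, N.factorial : ℕ) : ℝ) * ∑ a ∈ A, c a * ((∏ s, (u s).descFactorial (E a s) : ℕ) : ℝ)
      else 0 := by
    intro N u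
    rw [Finset.mul_sum, coeff_sum, Finset.sum_mul]
    have : ∀ a ∈ A, coeff u ((∏ j, ell β j) ^ N * monomial (E a) (c a)) *
      ((∏ s, (u s).factorial : ℕ) : ℝ) = if (∀ j, mdeg β u j = N + d j) then
      ((∏ j : κ, N.factorial : ℕ) : ℝ) * (c a * ((∏ s, (u s).descFactorial (E a s) : ℕ) : ℝ)) else 0 := by
      intro a ha
      have h1 := PInv_all β (E a) N u
      have h2 : (monomial (E a) (c a) : MvPolynomial σ ℝ) = C (c a) * monomial (E a) 1 := by
        rw [C_mul_monomial, mul_one]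
      rw [h2, mul_left_comm, coeff_C_mul, mul_assoc, h1]
      simp only [hE a ha]
      split_ifs
      · ring
      · simp
    rw [Finset.sum_congr rfl this]
    split_ifs
    · rw [Finset.mul_sum]
    · simp
  have fpos : ∀ u : σ →₀ ℕ, (0:ℝ) < ((∏ s, (u s).factorial : ℕ) : ℝ) := by
    intro u
    exact_mod_cast Finset.prod_pos (fun s _ => Nat.factorial_pos _)
  have hneg : ∀ N, (∀ j, mdeg β (U N) j = N + d j) ∧
      ∑ a ∈ A, c a * ((∏ s, (U N s).descFactorial (E a s) : ℕ) : ℝ) < 0 := by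
    intro N
    have h1 := formula N (U N)
    have h2 := mul_neg_of_neg_of_pos (hU N) (fpos (U N))
    rw [h1] at h2
    split_ifs at h2 with h3
    · refine ⟨h3, ?_⟩
      by_contra h4
      push Not at h4
      have := mul_nonneg (Nat.cast_nonneg (α := ℝ) (∏ j : κ, N.factorial)) h4
      linarith
    · exact absurd h2 (lt_irrefl _)
  -- sequence
  let D : ℕ → ℝ := fun N => (N : ℝ) + 1
  have Dpos : ∀ N, 0 < D N := fun N => by positivity
  let y : ℕ → σ → ℝ := fun N s => (U N s : ℝ) / D N
  have hbd : ∀ N, y N ∈ Set.Icc (0 : σ → ℝ) (fun s => 1 + (d (β s) : ℝ)) := by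
    intro N
    refine ⟨fun s => by simp only [y, Pi.zero_apply]; have := Dpos N; positivity, fun s => ?_⟩
    simp only [y]
    rw [div_le_iff₀ (Dpos N)]
    have h1 : U N s ≤ N + d (β s) := by
      rw [← (hneg N).1 (β s)]
      unfold mdeg
      exact Finset.single_le_sum (f := fun t => U N t) (fun _ _ => Nat.zero_le _) (by simp)
    have h2 : (U N s : ℝ) ≤ N + d (β s) := by exact_mod_cast h1
    simp only [D]
    have : (0:ℝ) ≤ d (β s) * N := by positivity
    nlinarith
  obtain ⟨x, hx, φ, hφ, hlim⟩ := isCompact_Icc.tendsto_subseq hbd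
  have hDt : Filter.Tendsto (fun m => D (φ m)) Filter.atTop Filter.atTop := by
    have : Filter.Tendsto D Filter.atTop Filter.atTop :=
      Filter.tendsto_atTop_add_const_right _ _ tendsto_natCast_atTop_atTop
    exact this.comp hφ.tendsto_atTop
  have hcoord : ∀ s, Filter.Tendsto (fun m => (U (φ m) s : ℝ) / D (φ m)) Filter.atTop (nhds (x s)) :=
    fun s => (tendsto_pi_nhds.1 hlim) s
  have hsum : ∀ j, ∑ s ∈ univ.filter (fun s => β s = j), x s = 1 := by
    intro j
    have h1 := tendsto_finsetSum (univ.filter (fun s => β s = j)) (fun s _ => hcoord s)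
    have h2 : Filter.Tendsto (fun m => 1 + ((d j : ℝ) - 1) / D (φ m)) Filter.atTop (nhds (1 + 0)) :=
      tendsto_const_nhds.add (hDt.const_div_atTop _)
    rw [add_zero] at h2
    refine tendsto_nhds_unique h1 (h2.congr fun m => ?_)
    rw [← Finset.sum_div, ← Nat.cast_sum]
    have := (hneg (φ m)).1 j
    unfold mdeg at this
    rw [this]
    have := (Dpos (φ m)).ne'
    field_simp
    simp only [D]
    push_cast
    ring
  have hp := hpos x (fun s => hx.1 s) hsum
  have hprodD : ∀ a ∈ A, ∀ m, ∏ s, D m ^ (E a s) = ∏ j, D m ^ d j := by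
    intro a ha m
    rw [Finset.prod_pow_eq_pow_sum, Finset.prod_pow_eq_pow_sum]
    congr 1
    rw [← Finset.sum_fiberwise univ β (fun s => E a s)]
    exact Finset.sum_congr rfl (fun j _ => hE a ha j)
  have hT : Filter.Tendsto (fun m => ∑ a ∈ A, c a * ∏ s, (((U (φ m) s).descFactorial (E a s) : ℝ)
      / D (φ m) ^ (E a s))) Filter.atTop (nhds (∑ a ∈ A, c a * ∏ s, x s ^ (E a s))) := by
    apply tendsto_finsetSum
    intro a _
    apply Filter.Tendsto.const_mul
    apply tendsto_finsetProd
    intro s _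
    exact desc_tendsto (fun m => U (φ m) s) (fun m => D (φ m)) hDt (x s) (hcoord s) _
  obtain ⟨m, hm⟩ := (hT.eventually (lt_mem_nhds hp)).exists
  have h1 : ∑ a ∈ A, c a * ∏ s, (((U (φ m) s).descFactorial (E a s) : ℝ)
      / D (φ m) ^ (E a s)) = (∑ a ∈ A, c a * ((∏ s, (U (φ m) s).descFactorial (E a s) : ℕ) : ℝ)) /
        ∏ j, D (φ m) ^ d j := by
    rw [Finset.sum_div]
    apply Finset.sum_congr rfl
    intro a ha
    rw [Finset.prod_div_distrib, hprodD a ha, Nat.cast_prod, mul_div_assoc]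
  rw [h1] at hm
  have h2 := div_neg_of_neg_of_pos (hneg (φ m)).2
    (Finset.prod_pos (s := univ) (fun j _ => pow_pos (Dpos (φ m)) (d j)))
  exact absurd hm (not_lt.2 h2.le)

end PolyaAbstract

section Cox
variable {n k : ℕ}

def blkB (blk : Fin n → Fin k) (j : Fin k) : Finset (Fin n) := univ.filter (fun i => blk i = j)

def bmap (blk : Fin n → Fin k) : Fin n ⊕ Fin k → Fin k := Sum.elim blk id

def coxE (B : Fin k → Finset (Fin n)) (d : Fin k → ℕ) (a : Fin n → ℤ) : (Fin n ⊕ Fin k) →₀ ℕ :=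
  (Finsupp.equivFunOnFinite.symm
      (Sum.elim (fun i => (a i).toNat) fun j => ((d j : ℤ) - ∑ i ∈ B j, a i).toNat))

def slackL (B : Fin k → Finset (Fin n)) (d : Fin k → ℕ) (p : Fin n → ℝ) : Fin n ⊕ Fin k → ℝ :=
  Sum.elim p (fun j => (d j : ℝ) - ∑ i ∈ B j, p i)

lemma sum_block {M : Type} [AddCommMonoid M] (blk : Fin n → Fin k) (j : Fin k)
    [DecidablePred fun s => bmap blk s = j] (f : Fin n ⊕ Fin k → M) :
    ∑ s ∈ univ.filter (fun s => bmap blk s = j), f s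
      = f (Sum.inr j) + ∑ i ∈ blkB blk j, f (Sum.inl i) := by
  rw [Finset.sum_filter, Fintype.sum_sum_type, blkB, Finset.sum_filter, add_comm]
  congr 1
  · rw [Finset.sum_eq_single j]
    · simp [bmap]
    · intro b _ hb
      rw [if_neg]
      simpa [bmap] using hb
    · simp
  · apply Finset.sum_congr rfl
    intro i _
    by_cases h : blk i = j <;> simp [bmap, h]

lemma ell_eq (blk : Fin n → Fin k) (j : Fin k) : ell (bmap blk) j = blockMul (blkB blk) j := by
  unfold ell blockMul
  rw [sum_block]

def InP (B : Fin k → Finset (Fin n)) (d : Fin k → ℕ) (p : Fin n → ℝ) : Prop :=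
  (∀ i, 0 ≤ p i) ∧ ∀ j, (∑ i ∈ B j, p i) ≤ (d j : ℝ)

lemma coxE_cast (B : Fin k → Finset (Fin n)) (d : Fin k → ℕ) (a : Fin n → ℤ)
    (ha : InP B d (castR a)) (s) : ((coxE B d a s : ℕ) : ℤ) =
      Sum.elim a (fun j => (d j : ℤ) - ∑ i ∈ B j, a i) s := by
  obtain ⟨h1, h2⟩ := ha
  rcases s with i | j
  · have := h1 i
    simp only [castR] at this
    have : 0 ≤ a i := by exact_mod_cast this
    simp [coxE, this]
  · have := h2 j
    simp only [castR] at this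
    have : ∑ i ∈ B j, a i ≤ d j := by exact_mod_cast this
    simp [coxE, this]

lemma coxE_castR (B : Fin k → Finset (Fin n)) (d : Fin k → ℕ) (a : Fin n → ℤ)
    (ha : InP B d (castR a)) (s) : ((coxE B d a s : ℕ) : ℝ) = slackL B d (castR a) s := by
  have := coxE_cast B d a ha s
  have h2 : ((coxE B d a s : ℕ) : ℝ) = (((coxE B d a s : ℕ) : ℤ) : ℝ) := by simp
  rw [h2, this]
  rcases s with i | j <;> simp [slackL, castR]

lemma mdeg_coxE (blk : Fin n → Fin k) (d : Fin k → ℕ) (a : Fin n → ℤ)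
    (ha : InP (blkB blk) d (castR a)) (j) : mdeg (bmap blk) (coxE (blkB blk) d a) j = d j := by
  unfold mdeg
  rw [sum_block]
  zify
  simp only [coxE_cast _ _ _ ha]
  simp

lemma evalE (blk : Fin n → Fin k) (d : Fin k → ℕ) (a : Fin n → ℤ)
    (ha : InP (blkB blk) d (castR a)) (z : Fin n ⊕ Fin k → ℝ) (hz : ∀ s, 0 < z s) :
    ∏ s, z s ^ (coxE (blkB blk) d a s) =
      (∏ j, z (Sum.inr j) ^ d j) * ∏ i, (z (Sum.inl i) / z (Sum.inr (blk i))) ^ (a i) := by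
  have h1 : ∀ s, z s ^ (coxE (blkB blk) d a s) =
      z s ^ (Sum.elim a (fun j => (d j : ℤ) - ∑ i ∈ blkB blk j, a i) s) := by
    intro s
    rw [← coxE_cast _ _ _ ha, zpow_natCast]
  simp only [h1]
  rw [Fintype.prod_sum_type]
  simp only [Sum.elim_inl, Sum.elim_inr, div_zpow, Finset.prod_div_distrib]
  have h2 : ∀ j, z (Sum.inr j) ^ ((d j : ℤ) - ∑ i ∈ blkB blk j, a i) =
      z (Sum.inr j) ^ d j / ∏ i ∈ blkB blk j, z (Sum.inr (blk i)) ^ a i := by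
    intro j
    rw [zpow_sub₀ (hz _).ne', zpow_natCast]
    congr 1
    have : ∀ S : Finset (Fin n), z (Sum.inr j) ^ (∑ i ∈ S, a i) = ∏ i ∈ S, z (Sum.inr j) ^ a i := by
      intro S
      induction S using Finset.induction_on with
      | empty => simp
      | insert i S hi ih => rw [Finset.sum_insert hi, Finset.prod_insert hi, zpow_add₀ (hz _).ne', ih]
    rw [this]
    apply Finset.prod_congr rfl
    intro i hi
    simp only [blkB, mem_filter, mem_univ, true_and] at hi
    rw [hi]
  simp only [h2, Finset.prod_div_distrib]
  simp only [blkB]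
  rw [Finset.prod_fiberwise univ blk (fun i => z (Sum.inr (blk i)) ^ a i)]
  ring

lemma dot_slack (blk : Fin n → Fin k) (d : Fin k → ℕ) (g : Fin n ⊕ Fin k → ℝ) (p : Fin n → ℝ) :
    dotR (fun i => g (Sum.inl i) - g (Sum.inr (blk i))) p =
      (∑ s, g s * slackL (blkB blk) d p s) - ∑ j, g (Sum.inr j) * d j := by
  rw [Fintype.sum_sum_type]
  simp only [dotR, slackL, Sum.elim_inl, Sum.elim_inr, sub_mul, mul_sub, Finset.sum_sub_distrib]
  have : ∑ j, g (Sum.inr j) * ∑ i ∈ blkB blk j, p i = ∑ i, g (Sum.inr (blk i)) * p i := by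
    rw [← Finset.sum_fiberwise univ blk (fun i => g (Sum.inr (blk i)) * p i)]
    apply Finset.sum_congr rfl
    intro j _
    rw [Finset.mul_sum]
    apply Finset.sum_congr rfl
    intro i hi
    simp only [blkB, mem_filter, mem_univ, true_and] at hi
    rw [hi]
  rw [this]
  ring

lemma slack_nonneg (B : Fin k → Finset (Fin n)) (d : Fin k → ℕ) (p : Fin n → ℝ) (hp : InP B d p) (s) :
    0 ≤ slackL B d p s := by
  rcases s with i | j
  · exact hp.1 i
  · simpa [slackL] using hp.2 j

lemma pos_of_copos (blk : Fin n → Fin k) (d : Fin k → ℕ) (A : Finset (Fin n → ℤ))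
    (hA : ∀ a ∈ A, InP (blkB blk) d (castR a)) (c : (Fin n → ℤ) → ℝ)
    (h : ∀ w t : Fin n → ℝ, (∀ i, 0 < t i) →
        0 < ∑ a ∈ A.filter (fun a => ∀ q, InP (blkB blk) d q →
                dotR w (castR a) ≤ dotR w q), c a * ∏ i, t i ^ (a i))
    (x : Fin n ⊕ Fin k → ℝ) (hx : ∀ s, 0 ≤ x s)
    (hs : ∀ j, x (Sum.inr j) + ∑ i ∈ blkB blk j, x (Sum.inl i) = 1) :
    0 < ∑ a ∈ A, c a * ∏ s, x s ^ (coxE (blkB blk) d a s) := by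
  let g : Fin n ⊕ Fin k → ℝ := fun s => if x s = 0 then 1 else 0
  have hg : ∀ s, 0 ≤ g s := fun s => by simp only [g]; split_ifs <;> norm_num
  let w : Fin n → ℝ := fun i => g (Sum.inl i) - g (Sum.inr (blk i))
  let x' : Fin n ⊕ Fin k → ℝ := fun s => if x s = 0 then 1 else x s
  have hx' : ∀ s, 0 < x' s := by
    intro s
    simp only [x']
    split_ifs with h0
    · norm_num
    · exact lt_of_le_of_ne (hx s) (Ne.symm h0)
  let p0 : Fin n → ℝ := fun i => d (blk i) * x (Sum.inl i)
  have hsum0 : ∀ j, ∑ i ∈ blkB blk j, p0 i = d j * (1 - x (Sum.inr j)) := by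
    intro j
    have := hs j
    have h1 : 1 - x (Sum.inr j) = ∑ i ∈ blkB blk j, x (Sum.inl i) := by linarith
    rw [h1, Finset.mul_sum]
    apply Finset.sum_congr rfl
    intro i hi
    simp only [blkB, mem_filter, mem_univ, true_and] at hi
    simp only [p0, hi]
  have hp0 : InP (blkB blk) d p0 := by
    refine ⟨fun i => mul_nonneg (Nat.cast_nonneg _) (hx _), fun j => ?_⟩
    rw [hsum0]
    have := mul_nonneg (Nat.cast_nonneg (α := ℝ) (d j)) (hx (Sum.inr j))
    linarith
  have hslack0 : ∀ s, g s * slackL (blkB blk) d p0 s = 0 := by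
    intro s
    simp only [g]
    split_ifs with h0
    · rcases s with i | j
      · simp [slackL, p0, h0]
      · simp [slackL, hsum0, h0]
    · simp
  have hmin : ∀ a ∈ A, ((∀ q, InP (blkB blk) d q → dotR w (castR a) ≤ dotR w q) ↔
      ∀ s, x s = 0 → coxE (blkB blk) d a s = 0) := by
    intro a ha
    constructor
    · intro hq s hs0
      have h1 := hq p0 hp0
      simp only [w] at h1
      rw [dot_slack blk d, dot_slack blk d] at h1
      simp only [hslack0, Finset.sum_const_zero] at h1
      have h2 : ∀ s, 0 ≤ g s * slackL (blkB blk) d (castR a) s :=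
        fun s => mul_nonneg (hg s) (slack_nonneg _ _ _ (hA a ha) s)
      have h3 := Finset.single_le_sum (f := fun s => g s * slackL (blkB blk) d (castR a) s)
        (fun s _ => h2 s) (mem_univ s)
      have h4 : g s * slackL (blkB blk) d (castR a) s = 0 := le_antisymm (by linarith) (h2 s)
      simp only [g, hs0, if_true, one_mul] at h4
      rw [← coxE_castR _ _ _ (hA a ha)] at h4
      exact_mod_cast h4
    · intro hz q hq
      simp only [w]
      rw [dot_slack blk d, dot_slack blk d]
      apply sub_le_sub_right
      apply Finset.sum_le_sum
      intro s _
      rw [← coxE_castR _ _ _ (hA a ha)]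
      by_cases h0 : x s = 0
      · rw [hz s h0]
        simpa using mul_nonneg (hg s) (slack_nonneg _ _ _ hq s)
      · simp [g, h0]
  have key := h w (fun i => x' (Sum.inl i) / x' (Sum.inr (blk i)))
    (fun i => div_pos (hx' _) (hx' _))
  have hY : 0 < ∏ j, x' (Sum.inr j) ^ d j := Finset.prod_pos (fun j _ => pow_pos (hx' _) _)
  have := mul_pos hY key
  rw [Finset.sum_filter, Finset.mul_sum] at this
  refine lt_of_lt_of_eq this (Finset.sum_congr rfl ?_)
  intro a ha
  split_ifs with hc
  · rw [mul_left_comm, ← evalE blk d a (hA a ha) x' hx']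
    congr 1
    apply Finset.prod_congr rfl
    intro s _
    by_cases h0 : x s = 0
    · rw [(hmin a ha).1 hc s h0]; simp
    · simp [x', h0]
  · rw [hmin a ha] at hc
    push Not at hc
    obtain ⟨s, h0, h1⟩ := hc
    rw [Finset.prod_eq_zero (mem_univ s)]
    · simp
    · rw [h0, zero_pow h1]

lemma dot_isLinear (w : Fin n → ℝ) : IsLinearMap ℝ (dotR w) := by
  constructor
  · intro x y; simp [dotR, mul_add, Finset.sum_add_distrib]
  · intro r x; simp only [dotR, Pi.smul_apply, smul_eq_mul, Finset.mul_sum]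
    exact Finset.sum_congr rfl (fun i _ => by ring)

lemma hull_supp (S : Set (Fin n → ℝ)) (A : Finset (Fin n → ℤ)) (c : (Fin n → ℤ) → ℝ)
    (hS : convexHull ℝ (castR '' (A : Set (Fin n → ℤ))) = S)
    (h : ∀ w t : Fin n → ℝ, (∀ i, 0 < t i) →
        0 < ∑ a ∈ A.filter (fun a => ∀ q ∈ S,
                dotR w (castR a) ≤ dotR w q), c a * ∏ i, t i ^ (a i)) :
    convexHull ℝ (castR '' ((A.filter fun a => c a ≠ 0) : Set (Fin n → ℤ))) = S := by
  apply Set.Subset.antisymm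
  · rw [← hS]
    apply convexHull_mono
    apply Set.image_mono
    intro a ha
    simp at ha ⊢
    exact ha.1
  · intro p hp
    by_contra hpn
    have hcl : IsClosed (convexHull ℝ (castR '' ((A.filter fun a => c a ≠ 0) : Set (Fin n → ℤ)))) := by
      apply Set.Finite.isClosed_convexHull
      exact (Finset.finite_toSet _).image _
    obtain ⟨f, u, h1, h2⟩ := geometric_hahn_banach_point_closed (convex_convexHull ℝ _) hcl hpn
    let w : Fin n → ℝ := fun i => f (Pi.single i 1)
    have hw : ∀ q, f q = dotR w q := by
      intro q
      have : q = ∑ i, q i • (Pi.single i (1:ℝ) : Fin n → ℝ) := by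
        ext j
        simp [Finset.sum_apply, Pi.single_apply]
      conv_lhs => rw [this]
      rw [map_sum]
      simp only [map_smul, dotR, w, smul_eq_mul]
      exact Finset.sum_congr rfl (fun i _ => mul_comm _ _)
    have := h w (fun _ => 1) (fun _ => one_pos)
    rw [Finset.sum_eq_zero] at this
    · exact lt_irrefl _ this
    · intro a ha
      rw [mem_filter] at ha
      by_cases hc : c a = 0
      · simp [hc]
      · exfalso
        have h3 := ha.2 p hp
        have h4 := h2 (castR a) (subset_convexHull ℝ _ ⟨a, by simp [hc, ha.1], rfl⟩)
        rw [hw] at h1 h4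
        linarith

lemma eval_ratio {σ : Type} [Fintype σ] (g : MvPolynomial σ ℝ) (hg : ∀ e, 0 ≤ coeff e g)
    (r : σ → ℝ) (hr : ∀ s, 0 < r s) : ∃ C : ℝ, 0 < C ∧ ∀ z : σ → ℝ, (∀ s, 0 < z s) →
      C * eval z g ≤ eval (fun s => r s * z s) g := by
  have hpos : ∀ e : σ →₀ ℕ, 0 < ∏ s, r s ^ e s := fun e => Finset.prod_pos fun s _ => pow_pos (hr s) _
  obtain ⟨C, hC, hCle⟩ : ∃ C : ℝ, 0 < C ∧ ∀ e ∈ g.support, C ≤ ∏ s, r s ^ e s := by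
    induction g.support using Finset.induction_on with
    | empty => exact ⟨1, one_pos, by simp⟩
    | insert e S _ ih =>
      obtain ⟨C, h1, h2⟩ := ih
      refine ⟨min C (∏ s, r s ^ e s), lt_min h1 (hpos e), ?_⟩
      intro e' he'
      rcases Finset.mem_insert.1 he' with rfl | h
      · exact min_le_right _ _
      · exact (min_le_left _ _).trans (h2 e' h)
  refine ⟨C, hC, fun z hz => ?_⟩
  rw [eval_eq', eval_eq', Finset.mul_sum]
  apply Finset.sum_le_sum
  intro e he
  simp only [mul_pow, Finset.prod_mul_distrib]
  have h1 : 0 ≤ coeff e g * ∏ s, z s ^ e s :=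
    mul_nonneg (hg e) (Finset.prod_nonneg fun s _ => pow_nonneg (hz s).le _)
  have := mul_le_mul_of_nonneg_right (hCle e he) h1
  linarith

lemma nonneg_mul_coeff {σ : Type} (p q : MvPolynomial σ ℝ) (hp : ∀ e, 0 ≤ coeff e p)
    (hq : ∀ e, 0 ≤ coeff e q) (e) : 0 ≤ coeff e (p * q) := by
  rw [coeff_mul]
  exact Finset.sum_nonneg fun x _ => mul_nonneg (hp _) (hq _)

lemma nonneg_pow_coeff {σ : Type} (p : MvPolynomial σ ℝ) (hp : ∀ e, 0 ≤ coeff e p) (N : ℕ)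
    (e) : 0 ≤ coeff e (p ^ N) := by
  induction N generalizing e with
  | zero => rw [pow_zero, coeff_one]; split_ifs <;> norm_num
  | succ N ih => rw [pow_succ]; exact nonneg_mul_coeff _ _ ih hp e

lemma nonneg_prod_coeff {σ κ : Type} (S : Finset κ) (p : κ → MvPolynomial σ ℝ)
    (hp : ∀ j e, 0 ≤ coeff e (p j))
    (e) : 0 ≤ coeff e (∏ j ∈ S, p j) := by
  induction S using Finset.induction_on generalizing e with
  | empty => rw [Finset.prod_empty, coeff_one]; split_ifs <;> norm_num
  | insert j S hj ih => rw [Finset.prod_insert hj]; exact nonneg_mul_coeff _ _ (hp j) ih e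

lemma nonneg_blockMul (B : Fin k → Finset (Fin n)) (j : Fin k) (e) : 0 ≤ coeff e (blockMul B j) := by
  unfold blockMul
  rw [coeff_add, coeff_sum]
  refine add_nonneg ?_ (Finset.sum_nonneg fun i _ => ?_) <;>
  · rw [coeff_X]; split_ifs <;> norm_num

lemma eval_blockMul_pos (B : Fin k → Finset (Fin n)) (j : Fin k) (z) (hz : ∀ s, 0 < z s) :
    0 < eval z (blockMul B j) := by
  unfold blockMul
  rw [map_add, map_sum]
  simp only [eval_X]
  exact add_pos_of_pos_of_nonneg (hz _) (Finset.sum_nonneg fun i _ => (hz _).le)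

lemma eval_cox (blk : Fin n → Fin k) (d : Fin k → ℕ) (A : Finset (Fin n → ℤ))
    (hA : ∀ a ∈ A, InP (blkB blk) d (castR a)) (c : (Fin n → ℤ) → ℝ) (t : Fin n → ℝ)
    (ht : ∀ i, 0 < t i) : eval (Sum.elim t (fun _ => 1)) (coxHomProd A (blkB blk) d c) =
      ∑ a ∈ A, c a * ∏ i, t i ^ (a i) := by
  have : coxHomProd A (blkB blk) d c = ∑ a ∈ A, monomial (coxE (blkB blk) d a) (c a) := rfl
  rw [this, map_sum]
  apply Finset.sum_congr rfl
  intro a ha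
  rw [eval_monomial, Finsupp.prod_fintype _ _ (by simp), evalE blk d a (hA a ha)]
  · simp
  · intro s; rcases s with i | j
    · exact ht i
    · simp

lemma ratio_cox (blk : Fin n → Fin k) (d : Fin k → ℕ) (A : Finset (Fin n → ℤ))
    (hA : ∀ a ∈ A, InP (blkB blk) d (castR a)) (c : (Fin n → ℤ) → ℝ) (N : Fin k → ℕ)
    (hN : ∀ e, 0 ≤ coeff e ((∏ j, blockMul (blkB blk) j ^ N j) * coxHomProd A (blkB blk) d c))
    (t t' : Fin n → ℝ) (ht : ∀ i, 0 < t i) (ht' : ∀ i, 0 < t' i) :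
    ∃ C : ℝ, 0 < C ∧ ∀ m : Fin n → ℝ, (∀ i, 0 < m i) →
      0 ≤ (∑ a ∈ A, c a * ∏ i, (t' i * m i) ^ (a i)) ∧
      C * (∑ a ∈ A, c a * ∏ i, (t' i * m i) ^ (a i)) ≤ ∑ a ∈ A, c a * ∏ i, (t i * m i) ^ (a i) := by
  set Q := ∏ j, blockMul (blkB blk) j ^ N j with hQ
  have hQn : ∀ e, 0 ≤ coeff e Q := fun e => nonneg_prod_coeff _ _
    (fun j e => nonneg_pow_coeff _ (nonneg_blockMul _ j) _ e) e
  have hQp : ∀ z, (∀ s, 0 < z s) → 0 < eval z Q := by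
    intro z hz
    rw [hQ, map_prod]
    exact Finset.prod_pos fun j _ => by rw [map_pow]; exact pow_pos (eval_blockMul_pos _ j z hz) _
  obtain ⟨C1, hC1, h1⟩ := eval_ratio _ hN (Sum.elim (fun i => t i / t' i) (fun _ => 1)) (by
    intro s; rcases s with i | j
    · exact div_pos (ht i) (ht' i)
    · simp)
  obtain ⟨C2, hC2, h2⟩ := eval_ratio Q hQn (Sum.elim (fun i => t' i / t i) (fun _ => 1)) (by
    intro s; rcases s with i | j
    · exact div_pos (ht' i) (ht i)
    · simp)
  refine ⟨C1 * C2, mul_pos hC1 hC2, fun m hm => ?_⟩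
  have hz' : ∀ s, 0 < (Sum.elim (fun i => t' i * m i) (fun _ => 1) : Fin n ⊕ Fin k → ℝ) s := by
    intro s; rcases s with i | j
    · exact mul_pos (ht' i) (hm i)
    · simp
  have hz : ∀ s, 0 < (Sum.elim (fun i => t i * m i) (fun _ => 1) : Fin n ⊕ Fin k → ℝ) s := by
    intro s; rcases s with i | j
    · exact mul_pos (ht i) (hm i)
    · simp
  rw [← eval_cox blk d A hA c (fun i => t' i * m i) (fun i => mul_pos (ht' i) (hm i)),
    ← eval_cox blk d A hA c (fun i => t i * m i) (fun i => mul_pos (ht i) (hm i))]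
  have e1 := h1 _ hz'
  have e2 := h2 _ hz
  have r1 : (fun s => (Sum.elim (fun i => t i / t' i) (fun _ => 1) : Fin n ⊕ Fin k → ℝ) s *
      (Sum.elim (fun i => t' i * m i) (fun _ => 1) : Fin n ⊕ Fin k → ℝ) s) =
      Sum.elim (fun i => t i * m i) (fun _ => 1) := by
    funext s; rcases s with i | j
    · have := (ht' i).ne'
      simp; field_simp
    · simp
  have r2 : (fun s => (Sum.elim (fun i => t' i / t i) (fun _ => 1) : Fin n ⊕ Fin k → ℝ) s *
      (Sum.elim (fun i => t i * m i) (fun _ => 1) : Fin n ⊕ Fin k → ℝ) s) =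
      Sum.elim (fun i => t' i * m i) (fun _ => 1) := by
    funext s; rcases s with i | j
    · have := (ht i).ne'
      simp; field_simp
    · simp
  rw [r1] at e1
  rw [r2] at e2
  have q1 := hQp _ hz
  have q2 := hQp _ hz'
  have e3 : 0 ≤ eval (Sum.elim (fun i => t' i * m i) (fun _ => 1))
      (Q * coxHomProd A (blkB blk) d c) := by
    rw [eval_eq']
    exact Finset.sum_nonneg fun e _ => mul_nonneg (hN e)
      (Finset.prod_nonneg fun s _ => pow_nonneg (hz' s).le _)
  rw [map_mul] at e3 e1
  rw [map_mul] at e1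
  generalize eval (Sum.elim (fun i => t' i * m i) (fun _ => 1)) (coxHomProd A (blkB blk) d c) = F' at *
  generalize eval (Sum.elim (fun i => t i * m i) (fun _ => 1)) (coxHomProd A (blkB blk) d c) = F at *
  generalize eval (Sum.elim (fun i => t i * m i) (fun _ => 1)) Q = q at *
  generalize eval (Sum.elim (fun i => t' i * m i) (fun _ => 1)) Q = q' at *
  have hF' : 0 ≤ F' := nonneg_of_mul_nonneg_right e3 q2
  refine ⟨hF', ?_⟩
  have e4 : C1 * ((C2 * q) * F') ≤ C1 * (q' * F') := by gcongr
  have e5 : q * (C1 * C2 * F') ≤ q * F := by linarith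
  exact le_of_mul_le_mul_left e5 q1

lemma trunc_limit (A : Finset (Fin n → ℤ)) (c : (Fin n → ℤ) → ℝ) (w : Fin n → ℝ) (μ : ℝ)
    (hμ : ∀ a ∈ A, μ ≤ dotR w (castR a)) (t : Fin n → ℝ) :
    Filter.Tendsto (fun l : ℝ => Real.exp (l * μ) *
      ∑ a ∈ A, c a * ∏ i, (t i * Real.exp (-(l * w i))) ^ (a i)) Filter.atTop
      (nhds (∑ a ∈ A.filter (fun a => dotR w (castR a) ≤ μ), c a * ∏ i, t i ^ (a i))) := by
  have h1 : ∀ l : ℝ, Real.exp (l * μ) *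
      ∑ a ∈ A, c a * ∏ i, (t i * Real.exp (-(l * w i))) ^ (a i) =
      ∑ a ∈ A, (c a * ∏ i, t i ^ (a i)) * Real.exp (-(l * (dotR w (castR a) - μ))) := by
    intro l
    rw [Finset.mul_sum]
    apply Finset.sum_congr rfl
    intro a _
    simp only [mul_zpow, Finset.prod_mul_distrib]
    have h5 : ∀ i, Real.exp (-(l * w i)) ^ a i = Real.exp ((a i : ℝ) * -(l * w i)) := by
      intro i
      rw [← Real.rpow_intCast, ← Real.exp_mul, mul_comm]
    simp only [h5, ← Real.exp_sum]
    have : ∑ i, (a i : ℝ) * -(l * w i) = - (l * dotR w (castR a)) := by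
      simp only [dotR, castR, Finset.mul_sum, ← Finset.sum_neg_distrib]
      exact Finset.sum_congr rfl fun i _ => by ring
    rw [this]
    have h2 : -(l * (dotR w (castR a) - μ)) = l * μ + -(l * dotR w (castR a)) := by ring
    rw [h2, Real.exp_add]
    ring
  simp only [h1]
  rw [Finset.sum_filter]
  apply tendsto_finsetSum
  intro a ha
  split_ifs with hc
  · have : dotR w (castR a) - μ = 0 := by have := hμ a ha; linarith
    simp [this]
  · have hpos : 0 < dotR w (castR a) - μ := by push Not at hc; linarith
    have h3 : Filter.Tendsto (fun l : ℝ => Real.exp (-(l * (dotR w (castR a) - μ)))) Filter.atTop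
        (nhds 0) :=
      Real.tendsto_exp_neg_atTop_nhds_zero.comp (Filter.tendsto_id.atTop_mul_const hpos)
    simpa using h3.const_mul (c a * ∏ i, t i ^ (a i))

lemma exists_pos_ne (S : Finset (Fin n → ℤ)) (c : (Fin n → ℤ) → ℝ) (hS : ∀ a ∈ S, ∀ i, 0 ≤ a i)
    (a0) (ha0 : a0 ∈ S) (hc : c a0 ≠ 0) :
    ∃ t : Fin n → ℝ, (∀ i, 0 < t i) ∧ ∑ a ∈ S, c a * ∏ i, t i ^ (a i) ≠ 0 := by
  by_contra hcon
  push Not at hcon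
  let em : (Fin n → ℤ) → (Fin n →₀ ℕ) := fun a => Finsupp.equivFunOnFinite.symm fun i => (a i).toNat
  let p : MvPolynomial (Fin n) ℝ := ∑ a ∈ S, monomial (em a) (c a)
  have hp : p = 0 := by
    haveI : Infinite (Set.Ioi (0:ℝ)) := (Set.Ioi_infinite 0).to_subtype
    apply MvPolynomial.funext_set (fun _ => Set.Ioi (0:ℝ)) (fun _ => Set.Ioi_infinite 0)
    intro t ht
    have ht' : ∀ i, 0 < t i := fun i => ht i (Set.mem_univ i)
    rw [map_zero, ← hcon t ht', map_sum]
    apply Finset.sum_congr rfl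
    intro a ha
    rw [eval_monomial, Finsupp.prod_fintype _ _ (by simp)]
    congr 1
    apply Finset.prod_congr rfl
    intro i _
    rw [← zpow_natCast]
    simp [em, hS a ha i]
  have hco : coeff (em a0) p = c a0 := by
    simp only [p]
    rw [coeff_sum, Finset.sum_eq_single a0]
    · simp
    · intro a ha hne
      rw [coeff_monomial, if_neg]
      intro h
      apply hne
      funext i
      have := DFunLike.congr_fun h i
      simp only [em, Finsupp.equivFunOnFinite_symm_apply_apply] at this
      have h1 := hS a ha i
      have h2 := hS a0 ha0 i
      omega
    · intro h; exact absurd ha0 h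
  rw [hp, coeff_zero] at hco
  exact hc hco.symm

lemma copos_of_nonneg (blk : Fin n → Fin k) (d : Fin k → ℕ) (A : Finset (Fin n → ℤ))
    (hA : ∀ a ∈ A, InP (blkB blk) d (castR a)) (c : (Fin n → ℤ) → ℝ)
    (hsupp : convexHull ℝ (castR '' ((A.filter fun a => c a ≠ 0) : Set (Fin n → ℤ))) =
      {p | InP (blkB blk) d p}) (N : Fin k → ℕ)
    (hN : ∀ e, 0 ≤ coeff e ((∏ j, blockMul (blkB blk) j ^ N j) * coxHomProd A (blkB blk) d c))
    (w t : Fin n → ℝ) (ht : ∀ i, 0 < t i) :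
        0 < ∑ a ∈ A.filter (fun a => ∀ q, InP (blkB blk) d q →
                dotR w (castR a) ≤ dotR w q), c a * ∏ i, t i ^ (a i) := by
  have hne : (A.filter fun a => c a ≠ 0).Nonempty := by
    rw [Finset.nonempty_iff_ne_empty]
    intro h0
    rw [h0] at hsupp
    simp only [Finset.coe_empty, Set.image_empty, convexHull_empty] at hsupp
    have : (0 : Fin n → ℝ) ∈ ({p | InP (blkB blk) d p} : Set (Fin n → ℝ)) := ⟨by simp, by simp⟩
    rw [← hsupp] at this
    exact this
  obtain ⟨a0, ha0, hmin⟩ := Finset.exists_min_image _ (fun a => dotR w (castR a)) hne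
  rw [mem_filter] at ha0
  have hall : ∀ q, InP (blkB blk) d q → dotR w (castR a0) ≤ dotR w q := by
    intro q hq
    have hq' : q ∈ convexHull ℝ (castR '' ((A.filter fun a => c a ≠ 0) : Set (Fin n → ℤ))) := by
      rw [hsupp]; exact hq
    have hsub : convexHull ℝ (castR '' ((A.filter fun a => c a ≠ 0) : Set (Fin n → ℤ))) ⊆
        {q | dotR w (castR a0) ≤ dotR w q} := by
      apply convexHull_min
      · rintro _ ⟨a, ha, rfl⟩
        exact hmin a ha
      · exact convex_halfSpace_ge (dot_isLinear w) _
    exact hsub hq'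
  have hfil : A.filter (fun a => ∀ q, InP (blkB blk) d q → dotR w (castR a) ≤ dotR w q) =
      A.filter (fun a => dotR w (castR a) ≤ dotR w (castR a0)) := by
    apply Finset.filter_congr
    intro a ha
    exact ⟨fun h => h _ (hA a0 ha0.1), fun h q hq => h.trans (hall q hq)⟩
  rw [hfil]
  obtain ⟨t', ht', hne'⟩ := exists_pos_ne (A.filter (fun a => dotR w (castR a) ≤ dotR w (castR a0))) c
    (by
      intro a ha i
      have := (hA a (mem_filter.1 ha).1).1 i
      simp only [castR] at this
      exact_mod_cast this) a0 (by simp [ha0.1]) ha0.2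
  obtain ⟨C, hC, hr⟩ := ratio_cox blk d A hA c N hN t t' ht ht'
  have hμ : ∀ a ∈ A, dotR w (castR a0) ≤ dotR w (castR a) := fun a ha => hall _ (hA a ha)
  have L := trunc_limit A c w _ hμ t
  have L' := trunc_limit A c w _ hμ t'
  have hm : ∀ l : ℝ, ∀ i, 0 < Real.exp (-(l * w i)) := fun l i => Real.exp_pos _
  have g1 := ge_of_tendsto' L' (fun l => mul_nonneg (Real.exp_pos _).le (hr _ (hm l)).1)
  have g2 := le_of_tendsto_of_tendsto' (L'.const_mul C) L (fun l => by
    have := mul_le_mul_of_nonneg_left (hr _ (hm l)).2 (Real.exp_pos (l * dotR w (castR a0))).le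
    linarith)
  exact lt_of_lt_of_le (mul_pos hC (lt_of_le_of_ne g1 (Ne.symm hne'))) g2

end Cox

/-- Theorem 4.9: Pólya's theorem in Cox coordinates for a product of full-dimensional
dilated standard simplices. -/
theorem polya_in_cox_product_of_standard_simplices
    {n k : ℕ} (hk : 1 ≤ k)
    (nn : Fin k → ℕ) (hnn : ∀ j, 1 ≤ nn j) (hn : n = ∑ j, nn j)
    (d : Fin k → ℕ) (hd : ∀ j, 1 ≤ d j)
    (B : Fin k → Finset (Fin n))
    (hBcard : ∀ j, (B j).card = nn j)
    (hBdisj : ∀ j j', j ≠ j' → Disjoint (B j) (B j'))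
    (hBcover : ∀ i : Fin n, ∃ j, i ∈ B j)
    (A : Finset (Fin n → ℤ))
    (hA : convexHull ℝ (castR '' (A : Set (Fin n → ℤ))) =
      {p : Fin n → ℝ | (∀ i, 0 ≤ p i) ∧ ∀ j, (∑ i ∈ B j, p i) ≤ (d j : ℝ)})
    (c : (Fin n → ℤ) → ℝ) :
    -- (i) ↔ (ii)
    ((∀ w t : Fin n → ℝ, (∀ i, 0 < t i) →
        0 < ∑ a ∈ A.filter (fun a =>
              ∀ q ∈ convexHull ℝ (castR '' (A : Set (Fin n → ℤ))),
                dotR w (castR a) ≤ dotR w q),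
            c a * ∏ i, t i ^ (a i)) ↔
      (convexHull ℝ (castR '' ((A.filter fun a => c a ≠ 0) : Set (Fin n → ℤ))) =
          {p : Fin n → ℝ | (∀ i, 0 ≤ p i) ∧ ∀ j, (∑ i ∈ B j, p i) ≤ (d j : ℝ)} ∧
        ∃ N : Fin k → ℕ, ∀ e : (Fin n ⊕ Fin k) →₀ ℕ,
          0 ≤ coeff e ((∏ j, blockMul B j ^ N j) * coxHomProd A B d c)))
    ∧
    -- (ii) ↔ (iii)
    ((convexHull ℝ (castR '' ((A.filter fun a => c a ≠ 0) : Set (Fin n → ℤ))) =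
          {p : Fin n → ℝ | (∀ i, 0 ≤ p i) ∧ ∀ j, (∑ i ∈ B j, p i) ≤ (d j : ℝ)} ∧
        ∃ N : Fin k → ℕ, ∀ e : (Fin n ⊕ Fin k) →₀ ℕ,
          0 ≤ coeff e ((∏ j, blockMul B j ^ N j) * coxHomProd A B d c)) ↔
      (convexHull ℝ (castR '' ((A.filter fun a => c a ≠ 0) : Set (Fin n → ℤ))) =
          {p : Fin n → ℝ | (∀ i, 0 ≤ p i) ∧ ∀ j, (∑ i ∈ B j, p i) ≤ (d j : ℝ)} ∧
        ∃ N : ℕ, ∀ e : (Fin n ⊕ Fin k) →₀ ℕ,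
          0 ≤ coeff e ((∏ j, blockMul B j) ^ N * coxHomProd A B d c))) := by
  have hex : ∃ blk : Fin n → Fin k, B = blkB blk := by
    choose blk hblk using hBcover
    refine ⟨blk, ?_⟩
    funext j
    ext i
    simp only [blkB, mem_filter, mem_univ, true_and]
    constructor
    · intro hi
      by_contra hne
      exact Finset.disjoint_left.1 (hBdisj _ _ hne) (hblk i) hi
    · rintro rfl
      exact hblk i
  obtain ⟨blk, rfl⟩ := hex
  have hAP : ∀ a ∈ A, InP (blkB blk) d (castR a) := by
    intro a ha
    have : castR a ∈ convexHull ℝ (castR '' (A : Set (Fin n → ℤ))) :=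
      subset_convexHull ℝ _ ⟨a, ha, rfl⟩
    rw [hA] at this
    exact this
  have i_iii : (∀ w t : Fin n → ℝ, (∀ i, 0 < t i) →
        0 < ∑ a ∈ A.filter (fun a =>
              ∀ q ∈ convexHull ℝ (castR '' (A : Set (Fin n → ℤ))),
                dotR w (castR a) ≤ dotR w q),
            c a * ∏ i, t i ^ (a i)) → (convexHull ℝ (castR '' ((A.filter fun a => c a ≠ 0) : Set (Fin n → ℤ))) =
          {p : Fin n → ℝ | (∀ i, 0 ≤ p i) ∧ ∀ j, (∑ i ∈ blkB blk j, p i) ≤ (d j : ℝ)} ∧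
        ∃ N : ℕ, ∀ e : (Fin n ⊕ Fin k) →₀ ℕ,
          0 ≤ coeff e ((∏ j, blockMul (blkB blk) j) ^ N * coxHomProd A (blkB blk) d c)) := by
    intro h
    rw [hA] at h
    refine ⟨hull_supp _ A c hA h, ?_⟩
    have := polya_abstract (bmap blk) A (coxE (blkB blk) d) c d
      (fun a ha j => mdeg_coxE blk d a (hAP a ha) j)
      (fun x hx hs => pos_of_copos blk d A hAP c h x hx (fun j => by have h5 := hs j; rw [sum_block] at h5; exact h5))
    simp only [ell_eq] at this
    exact this
  refine ⟨⟨fun h => ?_, fun h => ?_⟩, ⟨fun h => ⟨h.1, ?_⟩, fun h => ⟨h.1, ?_⟩⟩⟩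
  · obtain ⟨h1, N, hN⟩ := i_iii h
    refine ⟨h1, fun _ => N, ?_⟩
    rw [Finset.prod_pow]
    exact hN
  · obtain ⟨h1, N, hN⟩ := h
    rw [hA]
    intro w t ht
    exact copos_of_nonneg blk d A hAP c h1 N hN w t ht
  · obtain ⟨h1, N, hN⟩ := h
    refine ⟨∑ j, N j, fun e => ?_⟩
    have hle : ∀ j, N j ≤ ∑ j, N j := fun j =>
      Finset.single_le_sum (f := N) (fun _ _ => Nat.zero_le _) (mem_univ j)
    have : (∏ j, blockMul (blkB blk) j) ^ (∑ j, N j) =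
        (∏ j, blockMul (blkB blk) j ^ (∑ i, N i - N j)) * ∏ j, blockMul (blkB blk) j ^ N j := by
      rw [← Finset.prod_mul_distrib, ← Finset.prod_pow]
      apply Finset.prod_congr rfl
      intro j _
      rw [← pow_add, Nat.sub_add_cancel (hle j)]
    rw [this, mul_assoc]
    exact nonneg_mul_coeff _ _ (fun e => nonneg_prod_coeff _ _
      (fun j e => nonneg_pow_coeff _ (nonneg_blockMul _ j) _ e) e) hN e
  · obtain ⟨h1, N, hN⟩ := h
    refine ⟨fun _ => N, ?_⟩
    rw [Finset.prod_pow]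
    exact hN
end
end

section
/- Let a₁,…,a_{n+1} ∈ ℤⁿ be affinely independent, so Δ = conv(a₁,…,a_{n+1}) is a full-dimensional lattice simplex. Let F₁,…,F_{n+1} ∈ ℤⁿ be primitive integer vectors (the gcd of the entries of each F_i is 1) and b ∈ ℤ^{n+1} such that ⟨F_i,a_j⟩ + b_i = 0 for all j ≠ i and ⟨F_i,a_i⟩ + b_i > 0 for all i (so F_i is the primitive inner normal of the facet of Δ opposite a_i). Let M be the n×n matrix with columns a_1 − a_{n+1},…,a_n − a_{n+1}, and set v_i = det(M)/(⟨F_i,a_i⟩ + b_i) for i = 1,…,n+1. Then: (1) each v_i is an integer; (2) Σ_{i=1}^{n+1} v_i F_i = 0; (3) all v_i are nonzero and have the same sign, namely the sign of det(M). -/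
open Finset

noncomputable section

/-- Lemma 4.10: for a full-dimensional lattice simplex `Δ = conv(a₁,…,a_{n+1})` with
primitive inner facet normals `F₁,…,F_{n+1}`, the vector `v` with
`v_i = det(M)/(⟨F_i,a_i⟩+b_i)` has integer entries, lies in the kernel of the ray
generator matrix, and all its entries are nonzero with the sign of `det(M)`. -/
theorem kernel_vector_of_simplex
    {n : ℕ} (a : Fin (n + 1) → Fin n → ℤ)
    (haff : AffineIndependent ℝ (fun j => fun i => (a j i : ℝ)))
    (F : Fin (n + 1) → Fin n → ℤ)
    (hprim : ∀ i, Finset.univ.gcd (F i) = 1)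
    (b : Fin (n + 1) → ℤ)
    (hzero : ∀ i j, j ≠ i → (∑ l, F i l * a j l) + b i = 0)
    (hpos : ∀ i, 0 < (∑ l, F i l * a i l) + b i) :
    -- `M` has columns `a_j − a_{n+1}`, `j = 1,…,n`
    (∀ i : Fin (n + 1),
        ((∑ l, F i l * a i l) + b i) ∣
          (Matrix.of fun l j : Fin n => a j.castSucc l - a (Fin.last n) l).det) ∧
    (∑ i : Fin (n + 1),
        ((Matrix.of fun l j : Fin n => a j.castSucc l - a (Fin.last n) l).det /
          ((∑ l, F i l * a i l) + b i)) • F i) = 0 ∧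
    (∀ i : Fin (n + 1),
        (Matrix.of fun l j : Fin n => a j.castSucc l - a (Fin.last n) l).det /
            ((∑ l, F i l * a i l) + b i) ≠ 0 ∧
        Int.sign
            ((Matrix.of fun l j : Fin n => a j.castSucc l - a (Fin.last n) l).det /
              ((∑ l, F i l * a i l) + b i)) =
          Int.sign (Matrix.of fun l j : Fin n => a j.castSucc l - a (Fin.last n) l).det) := by
  classical
  set M : Matrix (Fin n) (Fin n) ℤ :=
    Matrix.of fun l j : Fin n => a j.castSucc l - a (Fin.last n) l with hM
  set d : Fin (n + 1) → ℤ := fun i => (∑ l, F i l * a i l) + b i with hd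
  have hd0 : ∀ i, 0 < d i := hpos
  have hval : ∀ i j, (∑ l, F i l * a j l) + b i = if j = i then d i else 0 := by
    intro i j
    split_ifs with h
    · subst h; rfl
    · exact hzero i j h
  have key : ∀ i j, (Matrix.vecMul (F i) M) j =
      (if j.castSucc = i then d i else 0) - (if Fin.last n = i then d i else 0) := by
    intro i j
    rw [← hval, ← hval]
    simp only [Matrix.vecMul, dotProduct, hM, Matrix.of_apply, mul_sub, Finset.sum_sub_distrib]
    ring
  have hdvd : ∀ i, d i ∣ M.det := by
    intro i
    have h1 : ∀ l ∈ (Finset.univ : Finset (Fin n)), d i ∣ M.det * F i l := by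
      intro l _
      have h2 : Matrix.vecMul (Matrix.vecMul (F i) M) M.adjugate = M.det • F i := by
        rw [Matrix.vecMul_vecMul, Matrix.mul_adjugate, Matrix.vecMul_smul, Matrix.vecMul_one]
      have h3 := congrFun h2 l
      simp only [Pi.smul_apply, smul_eq_mul] at h3
      rw [← h3]
      rw [Matrix.vecMul, dotProduct]
      refine Finset.dvd_sum fun j _ => dvd_mul_of_dvd_left (α := ℤ) ?_ _
      rw [key]
      refine dvd_sub ?_ ?_ <;> split_ifs <;> simp
    have h4 := Finset.dvd_gcd h1
    rw [Finset.gcd_mul_left, hprim, mul_one] at h4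
    exact (dvd_normalize_iff).1 h4
  have hdet : M.det ≠ 0 := by
    have h5 : (Matrix.of fun i : Fin n => F i.castSucc) * M =
        Matrix.diagonal fun i : Fin n => d i.castSucc := by
      ext i j
      have h6 := key i.castSucc j
      have h7 : Fin.last n ≠ i.castSucc := (Fin.castSucc_lt_last i).ne'
      rw [if_neg h7, sub_zero] at h6
      rw [Matrix.diagonal_apply]
      refine Eq.trans h6 ?_
      by_cases h : i = j
      · subst h; simp
      · rw [if_neg h, if_neg]
        intro h'
        exact h (Fin.castSucc_injective n h').symm
    intro h0
    have h8 := congrArg Matrix.det h5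
    rw [Matrix.det_mul, h0, mul_zero, Matrix.det_diagonal] at h8
    exact (Finset.prod_pos fun i _ => hd0 (Fin.castSucc i)).ne h8
  change (∀ i, d i ∣ M.det) ∧ (∑ i, (M.det / d i) • F i) = 0 ∧
    ∀ i, M.det / d i ≠ 0 ∧ Int.sign (M.det / d i) = Int.sign M.det
  refine ⟨hdvd, ?_, ?_⟩
  · apply Matrix.eq_zero_of_vecMul_eq_zero hdet
    rw [Matrix.sum_vecMul]
    ext j
    simp only [Finset.sum_apply, Matrix.smul_vecMul, Pi.smul_apply, key, smul_eq_mul, mul_sub,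
      Finset.sum_sub_distrib, mul_ite, mul_zero, Finset.sum_ite_eq, Finset.mem_univ, if_true,
      Int.ediv_mul_cancel (hdvd _), sub_self, Pi.zero_apply]
  · intro i
    obtain ⟨k, hk⟩ := hdvd i
    have hq : M.det / d i = k := by rw [hk, Int.mul_ediv_cancel_left _ (hd0 i).ne']
    rw [hq]
    refine ⟨fun h => hdet (by rw [hk, h, mul_zero]), ?_⟩
    rw [hk, Int.sign_mul, Int.sign_eq_one_of_pos (hd0 i), one_mul]
end
end

section
/- Let f = t₄³ + t₁t₄² − (19/10)t₂t₄² + t₂²t₄ + t₃t₄² + t₁t₃t₄ − (19/10)t₂t₃t₄ + t₂²t₃ ∈ ℝ[t₁,t₂,t₃,t₄]. For every N ∈ ℕ, the coefficient of the monomial t₂·t₃^{N+1}·t₄ in the polynomial (t₁+t₂+t₃+t₄)^N · f equals −19/10. -/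
open MvPolynomial

noncomputable section

/-- The polynomial `f` from Example 2.2 of the paper, in variables
`t₁ = X 0, t₂ = X 1, t₃ = X 2, t₄ = X 3`. -/
def examplePoly : MvPolynomial (Fin 4) ℝ :=
  X 3 ^ 3 + X 0 * X 3 ^ 2 - C (19 / 10) * (X 1 * X 3 ^ 2) + X 1 ^ 2 * X 3 +
    X 2 * X 3 ^ 2 + X 0 * X 2 * X 3 - C (19 / 10) * (X 1 * X 2 * X 3) + X 1 ^ 2 * X 2

theorem coeff_pow_aux (N : ℕ) :
    coeff (Finsupp.single 2 N) ((X 0 + X 1 + X 2 + X 3 : MvPolynomial (Fin 4) ℝ) ^ N) = 1 := by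
  induction N with
  | zero => simp
  | succ k ih =>
    have e : (Finsupp.single 2 (k + 1) : Fin 4 →₀ ℕ) - Finsupp.single 2 1 = Finsupp.single 2 k := by
      rw [← Finsupp.single_tsub]; simp
    simp [pow_succ, mul_add, coeff_mul_X', e, ih, Finsupp.single_apply]

theorem coeff_zero_aux (P : MvPolynomial (Fin 4) ℝ) (m : Fin 4 →₀ ℕ) (i : Fin 4) (k : ℕ)
    (h : m i < k) (Q : MvPolynomial (Fin 4) ℝ) : coeff m (P * (Q * X i ^ k)) = 0 := by
  rw [← mul_assoc, X_pow_eq_monomial, coeff_mul_monomial', if_neg]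
  intro hle
  have := hle i
  simp at this
  omega

/-- Example 2.2: for every `N`, the coefficient of `t₂ t₃^{N+1} t₄` in
`(t₁+t₂+t₃+t₄)^N · f` equals `−19/10`; hence no power of the standard Pólya
multiplier makes all coefficients nonnegative. -/
theorem example_no_classical_polya_certificate (N : ℕ) :
    coeff (Finsupp.single 1 1 + Finsupp.single 2 (N + 1) + Finsupp.single 3 1)
        ((X 0 + X 1 + X 2 + X 3) ^ N * examplePoly) = -(19 / 10) := by
  have hf : examplePoly = (X 3 + X 0 - C (19 / 10) * X 1 + X 2) * X 3 ^ 2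
      + (X 3 + X 2) * X 1 ^ 2 + (X 2 * X 3) * X 0 ^ 1
      + monomial (Finsupp.single 1 1 + Finsupp.single 2 1 + Finsupp.single 3 1) (-(19 / 10)) := by
    have : (monomial (Finsupp.single 1 1 + Finsupp.single 2 1 + Finsupp.single 3 1) (-(19 / 10)) :
        MvPolynomial (Fin 4) ℝ) = - (C (19 / 10) * (X 1 * X 2 * X 3)) := by
      simp only [X, C_mul_monomial, monomial_mul, ← map_neg]
      norm_num
    rw [this, examplePoly]
    ring
  have hm : (Finsupp.single 1 1 + Finsupp.single 2 (N + 1) + Finsupp.single 3 1 : Fin 4 →₀ ℕ)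
      = Finsupp.single 2 N + (Finsupp.single 1 1 + Finsupp.single 2 1 + Finsupp.single 3 1) := by
    rw [Finsupp.single_add]; abel
  rw [hf, mul_add, mul_add, mul_add, coeff_add, coeff_add, coeff_add,
    coeff_zero_aux _ _ 3 2 (by simp [Finsupp.single_apply]),
    coeff_zero_aux _ _ 1 2 (by simp [Finsupp.single_apply]),
    coeff_zero_aux _ _ 0 1 (by simp [Finsupp.single_apply]), hm, coeff_mul_monomial,
    coeff_pow_aux]
  norm_num
end
end

section
/- Let f = 2t₁⁴t₂² + t₁³t₂³ + t₁²t₂⁴ + 2t₁⁴t₂t₃ − 5t₁³t₂²t₃ − 2t₁t₂⁴t₃ + 2t₁⁴t₃² + t₁³t₂t₃² + 12t₁²t₂²t₃² + t₁t₂³t₃² + 2t₂⁴t₃² − 2t₁³t₃³ − 5t₁t₂²t₃³ + 2t₂³t₃³ + t₁²t₃⁴ + t₁t₂t₃⁴ + 2t₂²t₃⁴ ∈ ℝ[t₁,t₂,t₃], and let g₁ = t₁² + t₁t₂ + t₂² + t₁t₃ + t₂t₃ + t₃². For every N ∈ ℕ, the coefficient of the monomial t₁·t₂^{2N+4}·t₃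 in the polynomial g₁^N · f equals −2. -/
open MvPolynomial

noncomputable section

/-- The polynomial `f` from Example 5.5 of the paper, in variables
`t₁ = X 0, t₂ = X 1, t₃ = X 2`. -/
def hexPoly : MvPolynomial (Fin 3) ℝ :=
  C 2 * X 0 ^ 4 * X 1 ^ 2 + X 0 ^ 3 * X 1 ^ 3 + X 0 ^ 2 * X 1 ^ 4 +
    C 2 * X 0 ^ 4 * X 1 * X 2 - C 5 * X 0 ^ 3 * X 1 ^ 2 * X 2 -
    C 2 * X 0 * X 1 ^ 4 * X 2 + C 2 * X 0 ^ 4 * X 2 ^ 2 + X 0 ^ 3 * X 1 * X 2 ^ 2 +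
    C 12 * X 0 ^ 2 * X 1 ^ 2 * X 2 ^ 2 + X 0 * X 1 ^ 3 * X 2 ^ 2 +
    C 2 * X 1 ^ 4 * X 2 ^ 2 - C 2 * X 0 ^ 3 * X 2 ^ 3 - C 5 * X 0 * X 1 ^ 2 * X 2 ^ 3 +
    C 2 * X 1 ^ 3 * X 2 ^ 3 + X 0 ^ 2 * X 2 ^ 4 + X 0 * X 1 * X 2 ^ 4 +
    C 2 * X 1 ^ 2 * X 2 ^ 4

/-- The candidate Pólya multiplier `g₁` obtained from a Minkowski summand. -/
def hexMul : MvPolynomial (Fin 3) ℝ :=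
  X 0 ^ 2 + X 0 * X 1 + X 1 ^ 2 + X 0 * X 2 + X 1 * X 2 + X 2 ^ 2

theorem hex_decomp (N : ℕ) : ∃ A B : MvPolynomial (Fin 3) ℝ,
    hexMul ^ N * hexPoly = X 0 ^ 2 * A + X 2 ^ 2 * B - C 2 * (X 0 * X 1 ^ (2 * N + 4) * X 2) := by
  induction N with
  | zero =>
    refine ⟨C 2 * X 0 ^ 2 * X 1 ^ 2 + X 0 * X 1 ^ 3 + X 1 ^ 4 +
      C 2 * X 0 ^ 2 * X 1 * X 2 - C 5 * X 0 * X 1 ^ 2 * X 2 + C 2 * X 0 ^ 2 * X 2 ^ 2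
      + X 0 * X 1 * X 2 ^ 2 + C 12 * X 1 ^ 2 * X 2 ^ 2 - C 2 * X 0 * X 2 ^ 3 + X 2 ^ 4,
      X 0 * X 1 ^ 3 + C 2 * X 1 ^ 4 - C 5 * X 0 * X 1 ^ 2 * X 2 +
      C 2 * X 1 ^ 3 * X 2 + X 0 * X 1 * X 2 ^ 2 + C 2 * X 1 ^ 2 * X 2 ^ 2, ?_⟩
    unfold hexPoly
    ring
  | succ n ih =>
    obtain ⟨A, B, h⟩ := ih
    refine ⟨hexMul * A - C 2 * X 1 ^ (2 * n + 4) * X 2 * (X 0 + X 1 + X 2),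
      hexMul * B - C 2 * X 1 ^ (2 * n + 4) * X 0 * (X 1 + X 2), ?_⟩
    rw [pow_succ', mul_assoc, h]
    unfold hexMul
    ring

/-- Example 5.5: for every `N`, the coefficient of `t₁ t₂^{2N+4} t₃` in `g₁^N · f`
equals `−2`; hence Minkowski summands do not in general give Pólya multipliers. -/
theorem hexPoly_persistent_negative_coefficient (N : ℕ) :
    coeff (Finsupp.single 0 1 + Finsupp.single 1 (2 * N + 4) + Finsupp.single 2 1)
        (hexMul ^ N * hexPoly) = -2 := by
  obtain ⟨A, B, h⟩ := hex_decomp N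
  have e : (X 0 * X 1 ^ (2 * N + 4) * X 2 : MvPolynomial (Fin 3) ℝ) = monomial
      (Finsupp.single 0 1 + Finsupp.single 1 (2 * N + 4) + Finsupp.single 2 1) 1 := by
    simp [X, monomial_pow, monomial_mul]
  rw [h, e, coeff_sub, coeff_add, coeff_C_mul, coeff_monomial, if_pos rfl,
    X_pow_eq_monomial, X_pow_eq_monomial, coeff_monomial_mul', coeff_monomial_mul',
    if_neg, if_neg]
  · norm_num
  · intro hle
    have := hle 2
    simp at this
  · intro hle
    have := hle 0
    simp at this
end
end

section
/- Let λ₁, λ₂ be positive integers and let h ∈ ℝ[x₁,x₂,x₃,x₄] be the polynomial h = x₃^{λ₁}x₄^{2(2λ₁+λ₂)} + x₁^{λ₁}x₄^{2(2λ₁+λ₂)} + x₂^{λ₁+λ₂}x₃^{2λ₁}x₄^{2λ₁+λ₂} − 2x₁^{λ₁}x₂^{λ₁+λ₂}x₃^{λ₁}x₄^{2λ₁+λ₂} + x₁^{2λ₁}x₂^{λ₁+λ₂}x₄^{2λ₁+λ₂} + x₂^{2(λ₁+λ₂)}x₃^{3λ₁} + x₁^{λ₁}x₂^{2(λ₁+λ₂)}x₃^{2λ₁}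 + x₁^{2λ₁}x₂^{2(λ₁+λ₂)}x₃^{λ₁} + x₁^{3λ₁}x₂^{2(λ₁+λ₂)}. Then for every integer N ≥ λ₁, the coefficient of the monomial x₁^{N+λ₁}·x₂^{2N+λ₁+λ₂}·x₃^{N+λ₁}·x₄^{2λ₁+λ₂} in the polynomial (x₁x₂ + x₁x₄ + x₂x₃ + x₃x₄)^{2N} · h equals 2·(C(2N, N−λ₁) − C(2N, N)), where C(m,k) denotes the binomial coefficient; in particular this coefficient is strictly negative. -/
open MvPolynomial

noncomputable section

/-- The rescaled Cox homogenization `h = f_cox(x^v)` from Example 5.3 of the paper,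
with kernel vector `v = (λ₁, λ₁+λ₂, λ₁, 2λ₁+λ₂)`, in variables
`x₁ = X 0, x₂ = X 1, x₃ = X 2, x₄ = X 3`. -/
def coxExamplePoly (l1 l2 : ℕ) : MvPolynomial (Fin 4) ℝ :=
  X 2 ^ l1 * X 3 ^ (2 * (2 * l1 + l2)) + X 0 ^ l1 * X 3 ^ (2 * (2 * l1 + l2)) +
    X 1 ^ (l1 + l2) * X 2 ^ (2 * l1) * X 3 ^ (2 * l1 + l2) -
    C 2 * (X 0 ^ l1 * X 1 ^ (l1 + l2) * X 2 ^ l1 * X 3 ^ (2 * l1 + l2)) +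
    X 0 ^ (2 * l1) * X 1 ^ (l1 + l2) * X 3 ^ (2 * l1 + l2) +
    X 1 ^ (2 * (l1 + l2)) * X 2 ^ (3 * l1) +
    X 0 ^ l1 * X 1 ^ (2 * (l1 + l2)) * X 2 ^ (2 * l1) +
    X 0 ^ (2 * l1) * X 1 ^ (2 * (l1 + l2)) * X 2 ^ l1 +
    X 0 ^ (3 * l1) * X 1 ^ (2 * (l1 + l2))

def coxMon (a b c d : ℕ) : Fin 4 →₀ ℕ :=
  Finsupp.single 0 a + Finsupp.single 1 b + Finsupp.single 2 c + Finsupp.single 3 d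

lemma coxMon_inj (a b c d e f g h : ℕ) :
    coxMon a b c d = coxMon e f g h ↔ a = e ∧ b = f ∧ c = g ∧ d = h := by
  constructor
  · intro H
    have h0 := DFunLike.congr_fun H 0
    have h1 := DFunLike.congr_fun H 1
    have h2 := DFunLike.congr_fun H 2
    have h3 := DFunLike.congr_fun H 3
    simp [coxMon] at h0 h1 h2 h3
    exact ⟨h0, h1, h2, h3⟩
  · rintro ⟨rfl, rfl, rfl, rfl⟩
    rfl

lemma cox_monomial (a b c d : ℕ) :
    (X 0 ^ a * X 1 ^ b * X 2 ^ c * X 3 ^ d : MvPolynomial (Fin 4) ℝ) =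
      monomial (coxMon a b c d) 1 := by
  simp [X_pow_eq_monomial, monomial_mul, coxMon]

lemma cox_pow (n : ℕ) :
    ((X 0 * X 1 + X 0 * X 3 + X 1 * X 2 + X 2 * X 3) ^ n : MvPolynomial (Fin 4) ℝ) =
      ∑ i ∈ Finset.range (n + 1), ∑ j ∈ Finset.range (n + 1),
        C ((n.choose i : ℝ) * (n.choose j : ℝ)) *
          (X 0 ^ i * X 1 ^ j * X 2 ^ (n - i) * X 3 ^ (n - j)) := by
  have : (X 0 * X 1 + X 0 * X 3 + X 1 * X 2 + X 2 * X 3 : MvPolynomial (Fin 4) ℝ) =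
    (X 0 + X 2) * (X 1 + X 3) := by ring
  rw [this, mul_pow, add_pow, add_pow, Finset.sum_mul_sum]
  refine Finset.sum_congr rfl fun i _ => Finset.sum_congr rfl fun j _ => ?_
  simp only [C_mul, map_natCast]
  ring

lemma cox_coeff (n a b c d e f g h : ℕ) :
    coeff (coxMon a b c d)
      ((X 0 * X 1 + X 0 * X 3 + X 1 * X 2 + X 2 * X 3) ^ n *
        (X 0 ^ e * X 1 ^ f * X 2 ^ g * X 3 ^ h) : MvPolynomial (Fin 4) ℝ) =
      ∑ i ∈ Finset.range (n + 1), ∑ j ∈ Finset.range (n + 1),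
        if i + e = a ∧ j + f = b ∧ n - i + g = c ∧ n - j + h = d then
          (n.choose i : ℝ) * (n.choose j : ℝ) else 0 := by
  rw [cox_pow, Finset.sum_mul, coeff_sum]
  refine Finset.sum_congr rfl fun i _ => ?_
  rw [Finset.sum_mul, coeff_sum]
  refine Finset.sum_congr rfl fun j _ => ?_
  have : (C ((n.choose i : ℝ) * (n.choose j : ℝ)) *
          (X 0 ^ i * X 1 ^ j * X 2 ^ (n - i) * X 3 ^ (n - j)) *
          (X 0 ^ e * X 1 ^ f * X 2 ^ g * X 3 ^ h) : MvPolynomial (Fin 4) ℝ) =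
      C ((n.choose i : ℝ) * (n.choose j : ℝ)) *
        (X 0 ^ (i + e) * X 1 ^ (j + f) * X 2 ^ (n - i + g) * X 3 ^ (n - j + h)) := by
    ring
  rw [this, cox_monomial, coeff_C_mul, coeff_monomial]
  simp only [coxMon_inj, mul_ite, mul_one, mul_zero]

lemma cox_coeff_zero (n a b c d e f g h : ℕ) (H : a + c ≠ n + e + g) :
    coeff (coxMon a b c d)
      ((X 0 * X 1 + X 0 * X 3 + X 1 * X 2 + X 2 * X 3) ^ n *
        (X 0 ^ e * X 1 ^ f * X 2 ^ g * X 3 ^ h) : MvPolynomial (Fin 4) ℝ) = 0 := by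
  rw [cox_coeff]
  refine Finset.sum_eq_zero fun i hi => Finset.sum_eq_zero fun j hj => ?_
  rw [Finset.mem_range] at hi hj
  rw [if_neg]
  omega

lemma cox_coeff_pos (n a b c d e f g h i j : ℕ) (hi : i ≤ n) (hj : j ≤ n)
    (ha : i + e = a) (hb : j + f = b) (hc : n - i + g = c) (hd : n - j + h = d) :
    coeff (coxMon a b c d)
      ((X 0 * X 1 + X 0 * X 3 + X 1 * X 2 + X 2 * X 3) ^ n *
        (X 0 ^ e * X 1 ^ f * X 2 ^ g * X 3 ^ h) : MvPolynomial (Fin 4) ℝ) =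
      (n.choose i : ℝ) * (n.choose j : ℝ) := by
  rw [cox_coeff, Finset.sum_eq_single i, Finset.sum_eq_single j, if_pos ⟨ha, hb, hc, hd⟩]
  · intro k _ hk
    rw [if_neg]
    omega
  · intro H
    simp at H
    omega
  · intro k _ hk
    refine Finset.sum_eq_zero fun j hj => ?_
    rw [if_neg]
    omega
  · intro H
    simp at H
    omega

lemma coxExamplePoly_eq (l1 l2 : ℕ) : coxExamplePoly l1 l2 =
    X 0 ^ 0 * X 1 ^ 0 * X 2 ^ l1 * X 3 ^ (2 * (2 * l1 + l2)) +
    X 0 ^ l1 * X 1 ^ 0 * X 2 ^ 0 * X 3 ^ (2 * (2 * l1 + l2)) +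
    X 0 ^ 0 * X 1 ^ (l1 + l2) * X 2 ^ (2 * l1) * X 3 ^ (2 * l1 + l2) -
    C 2 * (X 0 ^ l1 * X 1 ^ (l1 + l2) * X 2 ^ l1 * X 3 ^ (2 * l1 + l2)) +
    X 0 ^ (2 * l1) * X 1 ^ (l1 + l2) * X 2 ^ 0 * X 3 ^ (2 * l1 + l2) +
    X 0 ^ 0 * X 1 ^ (2 * (l1 + l2)) * X 2 ^ (3 * l1) * X 3 ^ 0 +
    X 0 ^ l1 * X 1 ^ (2 * (l1 + l2)) * X 2 ^ (2 * l1) * X 3 ^ 0 +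
    X 0 ^ (2 * l1) * X 1 ^ (2 * (l1 + l2)) * X 2 ^ l1 * X 3 ^ 0 +
    X 0 ^ (3 * l1) * X 1 ^ (2 * (l1 + l2)) * X 2 ^ 0 * X 3 ^ 0 := by
  simp only [coxExamplePoly, pow_zero, one_mul, mul_one]

lemma cox_choose_lt (N l : ℕ) (hl : 0 < l) (hN : l ≤ N) :
    (2 * N).choose (N - l) < (2 * N).choose N := by
  have step : (2 * N).choose (N - 1) < (2 * N).choose N := by
    obtain ⟨M, rfl⟩ : ∃ M, N = M + 1 := ⟨N - 1, by omega⟩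
    have h1 := Nat.choose_succ_right_eq (2 * (M + 1)) M
    have hp : 0 < (2 * (M + 1)).choose M := Nat.choose_pos (by omega)
    have h2 : 2 * (M + 1) - M = M + 2 := by omega
    rw [h2] at h1
    simp only [Nat.add_sub_cancel]
    by_contra hcon
    push Not at hcon
    nlinarith
  refine lt_of_le_of_lt ?_ step
  have : ∀ k, k + 1 ≤ N → (2 * N).choose (N - 1 - k) ≤ (2 * N).choose (N - 1) := by
    intro k
    induction k with
    | zero => intro _; simp
    | succ k ih =>
      intro hk
      refine le_trans ?_ (ih (by omega))
      have h := Nat.choose_le_succ_of_lt_half_left (r := N - 1 - (k + 1)) (n := 2 * N) (by omega)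
      have e : N - 1 - (k + 1) + 1 = N - 1 - k := by omega
      rwa [e] at h
  have h := this (l - 1) (by omega)
  have e : N - 1 - (l - 1) = N - l := by omega
  rwa [e] at h

/-- Example 5.3: for all `N ≥ λ₁`, the coefficient of
`x₁^{N+λ₁} x₂^{2N+λ₁+λ₂} x₃^{N+λ₁} x₄^{2λ₁+λ₂}` in
`(x₁x₂ + x₁x₄ + x₂x₃ + x₃x₄)^{2N} · h` equals `2(C(2N,N−λ₁) − C(2N,N))`,
which is strictly negative. -/
theorem coxExample_persistent_negative_coefficient
    (l1 l2 : ℕ) (hl1 : 0 < l1) (hl2 : 0 < l2) (N : ℕ) (hN : l1 ≤ N) :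
    coeff
        (Finsupp.single 0 (N + l1) + Finsupp.single 1 (2 * N + l1 + l2) +
          Finsupp.single 2 (N + l1) + Finsupp.single 3 (2 * l1 + l2))
        ((X 0 * X 1 + X 0 * X 3 + X 1 * X 2 + X 2 * X 3) ^ (2 * N) *
          coxExamplePoly l1 l2) =
      2 * (((2 * N).choose (N - l1) : ℝ) - ((2 * N).choose N : ℝ)) ∧
    coeff
        (Finsupp.single 0 (N + l1) + Finsupp.single 1 (2 * N + l1 + l2) +
          Finsupp.single 2 (N + l1) + Finsupp.single 3 (2 * l1 + l2))
        ((X 0 * X 1 + X 0 * X 3 + X 1 * X 2 + X 2 * X 3) ^ (2 * N) *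
          coxExamplePoly l1 l2) < 0 := by
  have hlt : ((2 * N).choose (N - l1) : ℝ) < ((2 * N).choose N : ℝ) := by
    exact_mod_cast cox_choose_lt N l1 hl1 hN
  refine and_iff_left_of_imp (fun h => ?_) |>.mpr ?_
  · rw [h]
    linarith
  change coeff (coxMon _ _ _ _) _ = _
  have hsym : (2 * N).choose (N + l1) = (2 * N).choose (N - l1) :=
    Nat.choose_symm_of_eq_add (by omega)
  rw [coxExamplePoly_eq]
  have dist : ∀ P a b c d e f g h k : MvPolynomial (Fin 4) ℝ,
      P * (a + b + c - C 2 * d + e + f + g + h + k) = P * a + P * b + P * c - C 2 * (P * d) +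
        P * e + P * f + P * g + P * h + P * k := by
    intros
    ring
  rw [dist]
  simp only [coeff_add, coeff_sub, coeff_C_mul]
  rw [cox_coeff_zero (H := by omega), cox_coeff_zero (H := by omega),
    cox_coeff_pos (i := N + l1) (j := 2 * N) (hi := by omega) (hj := by omega)
      (ha := by omega) (hb := by omega) (hc := by omega) (hd := by omega),
    cox_coeff_pos (i := N) (j := 2 * N) (hi := by omega) (hj := by omega)
      (ha := by omega) (hb := by omega) (hc := by omega) (hd := by omega),
    cox_coeff_pos (i := N - l1) (j := 2 * N) (hi := by omega) (hj := by omega)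
      (ha := by omega) (hb := by omega) (hc := by omega) (hd := by omega),
    cox_coeff_zero (H := by omega), cox_coeff_zero (H := by omega),
    cox_coeff_zero (H := by omega), cox_coeff_zero (H := by omega), hsym]
  simp only [Nat.choose_self, Nat.cast_one]
  ring
end
end
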